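/- For n ≥ 1 let ℓ_n denote the critical length of the operator L_n = D^{n+1} + D^{n−1}, whose kernel is spanned by 1, x, …, x^{n−2}, cos x, sin x. For α > 0 define the Bessel function of the first kind J_α(x) = Σ_{m=0}^∞ (−1)^m / (m! · Γ(m+α+1)) · (x/2)^{2m+α} and let j_{α,1} := inf{x > 0 : J_α(x) = 0} be its first positive zero. Then for every k ≥ 1: ℓ_{2k} = ℓ_{2k+1} = 2·j_{k−1/2, 1} and ℓ_{2k+1} < ℓ_{2k+2}. -/

import Mathlib

open scoped BigOperators

noncomputable section

/-- `F` vanishes to order at least `m` at `x`: all derivatives of order `< m` vanish at `x`. -/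
def VanishAtLeast (F : ℝ → ℝ) (m : ℕ) (x : ℝ) : Prop :=
  ∀ j < m, iteratedDeriv j F x = 0

/-- `F` vanishes at most `N` times in `J`, counting multiplicities up to `μ`. -/
def VanishAtMost (F : ℝ → ℝ) (μ N : ℕ) (J : Set ℝ) : Prop :=
  ∀ (r : ℕ) (xs : Fin r → ℝ) (m : Fin r → ℕ),
    (∀ i, xs i ∈ J) → Function.Injective xs →
    (∀ i, 1 ≤ m i) → (∀ i, m i ≤ μ) →
    (∀ i, VanishAtLeast F (m i) (xs i)) →
    ∑ i, m i ≤ N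

/-- Kernel of the operator `L = D^(n+1) + ∑_{i=0}^n a i • D^i`. -/
def kerOp (n : ℕ) (a : Fin (n + 1) → ℝ) : Set (ℝ → ℝ) :=
  {F | ContDiff ℝ (⊤ : ℕ∞) F ∧
    ∀ x : ℝ, iteratedDeriv (n + 1) F x + ∑ i : Fin (n + 1), a i * iteratedDeriv (i : ℕ) F x = 0}

/-- The (restriction of the) kernel of `L` is an Extended Chebyshev space on `J`. -/
def IsECOn (n : ℕ) (a : Fin (n + 1) → ℝ) (J : Set ℝ) : Prop :=
  ∀ F ∈ kerOp n a, F ≠ 0 → VanishAtMost F (n + 1) n J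

/-- Critical length of the operator `L = D^(n+1) + ∑ a i • D^i`, as an extended real. -/
def critLen (n : ℕ) (a : Fin (n + 1) → ℝ) : EReal :=
  sSup {l : EReal | ∃ h : ℝ, l = (h : EReal) ∧ 0 < h ∧ IsECOn n a (Set.Icc 0 h)}

/-- Coefficient vector of the cycloidal operator `L_m = D^(m+1) + D^(m-1)`,
whose kernel is spanned by `1, x, …, x^(m-2), cos x, sin x`. -/
def trigCoeff (m : ℕ) : Fin (m + 1) → ℝ := fun i => if (i : ℕ) = m - 1 then 1 else 0

/-- The Bessel function of the first kind `J_α`. -/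
def besselJ (α : ℝ) (x : ℝ) : ℝ :=
  ∑' m : ℕ, ((-1 : ℝ) ^ m / ((m.factorial : ℝ) * Real.Gamma ((m : ℝ) + α + 1))) *
    (x / 2) ^ (2 * (m : ℝ) + α)

/-- The first positive zero `j_{α,1}` of the Bessel function `J_α`. -/
def besselFirstZero (α : ℝ) : ℝ := sInf {x : ℝ | 0 < x ∧ besselJ α x = 0}


/-! ### Vanishing orders -/

abbrev Smooth (F : ℝ → ℝ) : Prop := ContDiff ℝ (⊤ : ℕ∞) F

lemma Smooth.deriv' {F : ℝ → ℝ} (hF : Smooth F) : Smooth (deriv F) :=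
  ((contDiff_infty_iff_deriv).1 hF).2

lemma Smooth.diff {F : ℝ → ℝ} (hF : Smooth F) : Differentiable ℝ F :=
  ((contDiff_infty_iff_deriv).1 hF).1

lemma Smooth.iter {F : ℝ → ℝ} (hF : Smooth F) (n : ℕ) : Smooth (iteratedDeriv n F) := by
  induction n with
  | zero => simpa using hF
  | succ n ih => rw [iteratedDeriv_succ]; exact ih.deriv'

lemma van_zero (F : ℝ → ℝ) (x : ℝ) : VanishAtLeast F 0 x := fun j hj => absurd hj (by omega)

lemma van_succ {F : ℝ → ℝ} {m : ℕ} {x : ℝ} :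
    VanishAtLeast F (m + 1) x ↔ F x = 0 ∧ VanishAtLeast (deriv F) m x := by
  constructor
  · intro h
    refine ⟨by simpa using h 0 (by omega), fun j hj => ?_⟩
    have := h (j + 1) (by omega)
    rwa [iteratedDeriv_succ'] at this
  · rintro ⟨h0, h⟩ j hj
    cases j with
    | zero => simpa using h0
    | succ j => rw [iteratedDeriv_succ']; exact h j (by omega)

lemma van_mono {F : ℝ → ℝ} {m m' : ℕ} {x : ℝ} (h : VanishAtLeast F m x) (hm : m' ≤ m) :
    VanishAtLeast F m' x := fun j hj => h j (by omega)

lemma van_add {F G : ℝ → ℝ} {x : ℝ} (m : ℕ) (hF : Smooth F) (hG : Smooth G)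
    (h1 : VanishAtLeast F m x) (h2 : VanishAtLeast G m x) :
    VanishAtLeast (fun y => F y + G y) m x := by
  induction m generalizing F G with
  | zero => exact van_zero _ _
  | succ m ih =>
    rw [van_succ] at *
    refine ⟨by simp [h1.1, h2.1], ?_⟩
    have : deriv (fun y => F y + G y) = fun y => deriv F y + deriv G y := by
      ext y; exact deriv_add (hF.diff y) (hG.diff y)
    rw [this]
    exact ih hF.deriv' hG.deriv' h1.2 h2.2

lemma van_mul {u F : ℝ → ℝ} {x : ℝ} (m : ℕ) (hu : Smooth u) (hF : Smooth F)
    (h : VanishAtLeast F m x) : VanishAtLeast (fun y => u y * F y) m x := by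
  induction m generalizing u F with
  | zero => exact van_zero _ _
  | succ m ih =>
    have h0 := h
    rw [van_succ] at h ⊢
    refine ⟨by simp [h.1], ?_⟩
    have : deriv (fun y => u y * F y) = fun y => deriv u y * F y + u y * deriv F y := by
      ext y; exact deriv_mul (hu.diff y) (hF.diff y)
    rw [this]
    exact van_add m (hu.deriv'.mul hF) (hu.mul hF.deriv')
      (ih hu.deriv' hF (van_mono h0 (by omega))) (ih hu hF.deriv' h.2)

lemma van_neg {F : ℝ → ℝ} {x : ℝ} (m : ℕ) (hF : Smooth F)
    (h : VanishAtLeast F m x) : VanishAtLeast (fun y => - F y) m x := by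
  have := van_mul (u := fun _ => -1) m contDiff_const hF h
  simpa using this

lemma van_sub {F G : ℝ → ℝ} {x : ℝ} (m : ℕ) (hF : Smooth F) (hG : Smooth G)
    (h1 : VanishAtLeast F m x) (h2 : VanishAtLeast G m x) :
    VanishAtLeast (fun y => F y - G y) m x := by
  have := van_add m hF hG.neg h1 (van_neg m hG h2)
  simpa [sub_eq_add_neg] using this

lemma van_of_mul {u F : ℝ → ℝ} {x : ℝ} (m : ℕ) (hu : Smooth u) (hF : Smooth F) (hx : u x ≠ 0)
    (h : VanishAtLeast (fun y => u y * F y) m x) : VanishAtLeast F m x := by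
  induction m generalizing F with
  | zero => exact van_zero _ _
  | succ m ih =>
    have h1 : VanishAtLeast F m x := ih hF (van_mono h (by omega))
    rw [van_succ] at h ⊢
    have h0 : F x = 0 := by simpa [hx] using h.1
    refine ⟨h0, ?_⟩
    have : deriv (fun y => u y * F y) = fun y => deriv u y * F y + u y * deriv F y := by
      ext y; exact deriv_mul (hu.diff y) (hF.diff y)
    rw [this] at h
    have h3 := van_sub m ((hu.deriv'.mul hF).add (hu.mul hF.deriv')) (hu.deriv'.mul hF) h.2
      (van_mul m hu.deriv' hF h1)
    apply ih hF.deriv'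
    simpa using h3

/-- two-function Wronskian -/
def wr (u F : ℝ → ℝ) : ℝ → ℝ := fun y => u y * deriv F y - deriv u y * F y

lemma wr_smooth {u F : ℝ → ℝ} (hu : Smooth u) (hF : Smooth F) : Smooth (wr u F) :=
  (hu.mul hF.deriv').sub (hu.deriv'.mul hF)

lemma van_wr {u F : ℝ → ℝ} {x : ℝ} (m : ℕ) (hu : Smooth u) (hF : Smooth F)
    (h : VanishAtLeast F (m + 1) x) : VanishAtLeast (wr u F) m x := by
  have h' := van_succ.1 h
  exact van_sub m (hu.mul hF.deriv') (hu.deriv'.mul hF) (van_mul m hu hF.deriv' h'.2)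
    (van_mul m hu.deriv' hF (van_mono h (by omega)))

lemma van_of_wr {u G : ℝ → ℝ} {x : ℝ} (m : ℕ) (hu : Smooth u) (hG : Smooth G) (hx : u x ≠ 0)
    (h0 : G x = 0) (h : VanishAtLeast (wr u G) m x) : VanishAtLeast G (m + 1) x := by
  induction m with
  | zero => rw [van_succ]; exact ⟨h0, van_zero _ _⟩
  | succ m ih =>
    have h1 := ih (van_mono h (by omega))
    rw [van_succ]
    refine ⟨h0, van_of_mul _ hu hG.deriv' hx ?_⟩
    have := van_add (m+1) (wr_smooth hu hG) (hu.deriv'.mul hG) h (van_mul (m+1) hu.deriv' hG h1)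
    simpa [wr] using this

/-- `F` has at least `N` zeros in `J` counted with multiplicity. -/
def HasZeros (F : ℝ → ℝ) (J : Set ℝ) (N : ℕ) : Prop :=
  ∃ (s : Finset ℝ) (m : ℝ → ℕ), (∀ x ∈ s, x ∈ J) ∧ (∀ x ∈ s, VanishAtLeast F (m x) x) ∧
    N ≤ ∑ x ∈ s, m x

lemma hasZeros_pt {F : ℝ → ℝ} {J : Set ℝ} {N : ℕ} (h : HasZeros F J (N + 1)) :
    ∃ x ∈ J, F x = 0 := by
  obtain ⟨s, m, hs, hv, hN⟩ := h
  have : ∑ x ∈ s, m x ≠ 0 := by omega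
  obtain ⟨x, hx, hmx⟩ := Finset.exists_ne_zero_of_sum_ne_zero this
  refine ⟨x, hs x hx, ?_⟩
  simpa using hv x hx 0 (by omega)

lemma rolle_aux {F u : ℝ → ℝ} {J : Set ℝ} (hJ : J.OrdConnected) (hu : Smooth u) (hF : Smooth F)
    (hne : ∀ x ∈ J, u x ≠ 0) (m : ℝ → ℕ) (s : Finset ℝ) :
    s.Nonempty → (∀ x ∈ s, x ∈ J) → (∀ x ∈ s, 1 ≤ m x) → (∀ x ∈ s, VanishAtLeast F (m x) x) →
    ∃ (s' : Finset ℝ) (m' : ℝ → ℕ), (∀ x ∈ s', x ∈ J) ∧ (∀ x ∈ s', ∃ y ∈ s, x ≤ y) ∧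
      (∀ x ∈ s', VanishAtLeast (wr u F) (m' x) x) ∧ ∑ x ∈ s, m x ≤ (∑ x ∈ s', m' x) + 1 := by
  classical
  induction s using Finset.induction_on_max with
  | empty => intro h; simp at h
  | insert a s ha ih =>
    intro _ hsJ hm hv
    have has : a ∉ s := fun h => lt_irrefl _ (ha a h)
    have hva : VanishAtLeast (wr u F) (m a - 1) a := by
      apply van_wr _ hu hF
      have := hm a (by simp)
      rw [Nat.sub_add_cancel this]
      exact hv a (by simp)
    rcases s.eq_empty_or_nonempty with rfl | hne'
    · refine ⟨{a}, fun _ => m a - 1, ?_, ?_, ?_, ?_⟩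
      · simpa using hsJ
      · simp
      · simpa using hva
      · simp; omega
    · obtain ⟨s', m', h1, h2, h3, h4⟩ := ih hne' (fun x hx => hsJ x (by simp [hx]))
        (fun x hx => hm x (by simp [hx])) (fun x hx => hv x (by simp [hx]))
      set b := s.max' hne' with hb
      have hbs : b ∈ s := s.max'_mem hne'
      have hba : b < a := ha b hbs
      have hIcc : Set.Icc b a ⊆ J := hJ.out (hsJ b (by simp [hbs])) (hsJ a (by simp))
      have hFb : F b = 0 := by
        have := hv b (by simp [hbs]) 0 (hm b (by simp [hbs])); simpa using this
      have hFa : F a = 0 := by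
        have := hv a (by simp) 0 (hm a (by simp)); simpa using this
      obtain ⟨ξ, hξ, hd⟩ : ∃ ξ ∈ Set.Ioo b a, wr u F ξ = 0 := by
        obtain ⟨ξ, hξ, hd⟩ := exists_hasDerivAt_eq_zero (f := fun x => F x / u x)
          (f' := fun x => (deriv F x * u x - F x * deriv u x) / u x ^ 2) hba
          (ContinuousOn.div hF.continuous.continuousOn hu.continuous.continuousOn
            (fun x hx => hne x (hIcc hx))) (by simp [hFb, hFa])
          (fun x hx => ((hF.diff x).hasDerivAt).div ((hu.diff x).hasDerivAt)
            (hne x (hIcc ⟨hx.1.le, hx.2.le⟩)))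
        refine ⟨ξ, hξ, ?_⟩
        have hux := hne ξ (hIcc ⟨hξ.1.le, hξ.2.le⟩)
        have : deriv F ξ * u ξ - F ξ * deriv u ξ = 0 := by
          rcases div_eq_zero_iff.1 hd with h | h
          · exact h
          · exact absurd h (pow_ne_zero _ hux)
        simp only [wr]; linarith
      have hle : ∀ x ∈ s', x ≤ b := fun x hx => by
        obtain ⟨y, hy, hxy⟩ := h2 x hx
        exact hxy.trans (s.le_max' y hy)
      have hξs : ξ ∉ s' := fun h => absurd (hle ξ h) (not_le.2 hξ.1)
      have has' : a ∉ s' := fun h => absurd (hle a h) (not_le.2 hba)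
      have hξa : ξ ≠ a := hξ.2.ne
      refine ⟨insert a (insert ξ s'), fun x => if x = a then m a - 1 else if x = ξ then 1 else m' x,
        ?_, ?_, ?_, ?_⟩
      · intro x hx
        simp only [Finset.mem_insert] at hx
        rcases hx with rfl | rfl | hx
        · exact hsJ _ (by simp)
        · exact hIcc ⟨hξ.1.le, hξ.2.le⟩
        · exact h1 x hx
      · intro x hx
        refine ⟨a, by simp, ?_⟩
        simp only [Finset.mem_insert] at hx
        rcases hx with rfl | rfl | hx
        · exact le_rfl
        · exact hξ.2.le
        · exact (hle x hx).trans hba.le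
      · intro x hx
        simp only [Finset.mem_insert] at hx
        rcases hx with rfl | rfl | hx
        · simpa using hva
        · simp only [hξa, if_false, if_true]
          rw [van_succ]; exact ⟨hd, van_zero _ _⟩
        · have e1 : x ≠ a := fun h => has' (h ▸ hx)
          have e2 : x ≠ ξ := fun h => hξs (h ▸ hx)
          simp only [e1, e2, if_false]
          exact h3 x hx
      · rw [Finset.sum_insert has, Finset.sum_insert (by simp [hξa.symm, has']),
          Finset.sum_insert hξs]
        have : ∑ x ∈ s', (if x = a then m a - 1 else if x = ξ then 1 else m' x) =
            ∑ x ∈ s', m' x := by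
          apply Finset.sum_congr rfl
          intro x hx
          have e1 : x ≠ a := fun h => has' (h ▸ hx)
          have e2 : x ≠ ξ := fun h => hξs (h ▸ hx)
          simp [e1, e2]
        rw [this]
        have := hm a (by simp)
        simp only [hξa, if_false, if_true]
        omega

lemma hasZeros_wr {F u : ℝ → ℝ} {J : Set ℝ} (hJ : J.OrdConnected) (hu : Smooth u) (hF : Smooth F)
    (hne : ∀ x ∈ J, u x ≠ 0) {N : ℕ} (h : HasZeros F J (N + 1)) : HasZeros (wr u F) J N := by
  classical
  obtain ⟨s, m, hs, hv, hN⟩ := h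
  have hsum : ∑ x ∈ s.filter (fun x => m x ≠ 0), m x = ∑ x ∈ s, m x :=
    Finset.sum_filter_ne_zero s
  have hnon : (s.filter (fun x => m x ≠ 0)).Nonempty := by
    rw [Finset.nonempty_iff_ne_empty]
    intro h
    rw [h] at hsum
    simp only [Finset.sum_empty] at hsum
    omega
  obtain ⟨s', m', h1, h2, h3, h4⟩ := rolle_aux hJ hu hF hne m _ hnon
    (fun x hx => hs x (Finset.mem_filter.1 hx).1)
    (fun x hx => Nat.one_le_iff_ne_zero.2 (Finset.mem_filter.1 hx).2)
    (fun x hx => hv x (Finset.mem_filter.1 hx).1)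
  exact ⟨s', m', h1, h3, by omega⟩

lemma hasZeros_deriv {F : ℝ → ℝ} {J : Set ℝ} (hJ : J.OrdConnected) (hF : Smooth F)
    {N : ℕ} (h : HasZeros F J (N + 1)) : HasZeros (deriv F) J N := by
  have := hasZeros_wr (u := fun _ => 1) hJ contDiff_const hF (by simp) h
  have e : wr (fun _ => 1) F = deriv F := by ext x; simp [wr]
  rwa [e] at this

lemma eq_zero_of_deriv_zero {F : ℝ → ℝ} {x : ℝ} (hF : Smooth F) (h : deriv F = 0) (hx : F x = 0) :
    F = 0 := by
  ext y
  rw [is_const_of_deriv_eq_zero hF.diff (fun z => by rw [h]; rfl) y x, hx]; rfl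

lemma poly_zero {F : ℝ → ℝ} (m : ℕ) (hF : Smooth F) (h0 : iteratedDeriv m F = 0)
    (h : HasZeros F Set.univ m) : F = 0 := by
  induction m generalizing F with
  | zero => simpa using h0
  | succ m ih =>
    rw [iteratedDeriv_succ'] at h0
    have h1 := ih hF.deriv' h0 (hasZeros_deriv Set.ordConnected_univ hF h)
    obtain ⟨x, -, hx⟩ := hasZeros_pt h
    exact eq_zero_of_deriv_zero hF h1 hx

/-- linear combination -/
def lc (u : ℕ → ℝ → ℝ) (c : ℕ → ℝ) (j : ℕ) : ℝ → ℝ := fun x => ∑ r ∈ Finset.range j, c r * u r x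

lemma lc_smooth {u : ℕ → ℝ → ℝ} (hu : ∀ r, Smooth (u r)) (c : ℕ → ℝ) (j : ℕ) :
    Smooth (lc u c j) := by
  unfold lc
  exact ContDiff.sum (fun r _ => contDiff_const.mul (hu r))

lemma deriv_lc {u : ℕ → ℝ → ℝ} (hu : ∀ r, Smooth (u r)) (c : ℕ → ℝ) (j : ℕ) :
    deriv (lc u c j) = lc (fun r => deriv (u r)) c j := by
  ext x
  unfold lc
  rw [deriv_fun_sum (fun r _ => ((hu r).diff x).const_mul (c r))]
  exact Finset.sum_congr rfl (fun r _ => deriv_const_mul _ ((hu r).diff x))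

lemma wr_lc {u : ℕ → ℝ → ℝ} {v : ℝ → ℝ} (hu : ∀ r, Smooth (u r)) (c : ℕ → ℝ) (j : ℕ) :
    wr v (lc u c j) = lc (fun r => wr v (u r)) c j := by
  ext x
  simp only [wr, deriv_lc hu]
  simp only [lc, Finset.mul_sum, ← Finset.sum_sub_distrib]
  exact Finset.sum_congr rfl (fun r _ => by simp only [wr]; ring)

lemma lc_succ (u : ℕ → ℝ → ℝ) (c : ℕ → ℝ) (j : ℕ) (x : ℝ) :
    lc u c (j + 1) x = lc (fun r => u (r + 1)) (fun r => c (r + 1)) j x + c 0 * u 0 x := by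
  simp [lc, Finset.sum_range_succ']

theorem flag {I : Set ℝ} (hI : I.OrdConnected) (N : ℕ) :
    ∀ (u : ℕ → ℝ → ℝ), (∀ r, Smooth (u r)) →
    (∀ x ∈ I, ∀ j ≤ N, ∀ c : ℕ → ℝ, VanishAtLeast (lc u c j) j x → ∀ r < j, c r = 0) →
    ∀ c : ℕ → ℝ, HasZeros (lc u c N) I N → ∀ r < N, c r = 0 := by
  induction N with
  | zero => intro u _ _ c _ r hr; omega
  | succ N ih =>
    intro u hu H c hz
    have hne : ∀ x ∈ I, u 0 x ≠ 0 := by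
      intro x hx h0
      have := H x hx 1 (by omega) (fun _ => 1) (by
        rw [van_succ]; exact ⟨by simp [lc, h0], van_zero _ _⟩) 0 (by omega)
      norm_num at this
    have hdec : ∀ (c : ℕ → ℝ) j, lc u c (j+1) =
        fun x => lc (fun r => u (r + 1)) (fun r => c (r + 1)) j x + c 0 * u 0 x := fun c j => by
      ext x; exact lc_succ u c j x
    have hwr : ∀ (c : ℕ → ℝ) j, wr (u 0) (lc u c (j+1)) =
        lc (fun r => wr (u 0) (u (r+1))) (fun r => c (r + 1)) j := by
      intro c j
      rw [wr_lc hu]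
      ext x
      rw [lc_succ]
      simp [wr, mul_comm]
    have h1 := ih (fun r => wr (u 0) (u (r+1))) (fun r => wr_smooth (hu 0) (hu _)) (by
      intro x hx j hj c hv r hr
      set c' : ℕ → ℝ := fun r => match r with
        | 0 => - lc (fun r => u (r + 1)) c j x / u 0 x
        | r + 1 => c r with hc'
      have e := hwr c' j
      have hv' : VanishAtLeast (wr (u 0) (lc u c' (j+1))) j x := by rw [e]; exact hv
      have h2 := van_of_wr j (hu 0) (lc_smooth hu c' (j+1)) (hne x hx) (by
        rw [lc_succ]
        simp only [hc']
        field_simp [hne x hx]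
        ring) hv'
      exact H x hx (j+1) (by omega) c' h2 (r+1) (by omega)) (fun r => c (r + 1)) (by
        have := hasZeros_wr hI (hu 0) (lc_smooth hu c (N+1)) hne hz
        rwa [hwr] at this)
    obtain ⟨x, hx, hFx⟩ := hasZeros_pt hz
    have h0 : c 0 = 0 := by
      rw [lc_succ] at hFx
      have : lc (fun r => u (r + 1)) (fun r => c (r + 1)) N x = 0 := by
        unfold lc
        exact Finset.sum_eq_zero (fun r hr => by simp [h1 r (Finset.mem_range.1 hr)])
      rw [this, zero_add] at hFx
      exact (mul_eq_zero.1 hFx).resolve_right (hne x hx)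
    intro r hr
    cases r with
    | zero => exact h0
    | succ r => exact h1 r (by omega)

/-! ### The Peano functionals -/

/-- `Iop p g q h = ∫_0^h x^p/p! (h-x)^q/q! g(x) dx`, defined by iterated integration. -/
def Iop (p : ℕ) (g : ℝ → ℝ) : ℕ → ℝ → ℝ
  | 0 => fun h => ∫ x in (0:ℝ)..h, x ^ p / (p.factorial : ℝ) * g x
  | q + 1 => fun h => ∫ x in (0:ℝ)..h, Iop p g q x

lemma eq_of_hasDerivAt {f g f' : ℝ → ℝ} (hf : ∀ x, HasDerivAt f (f' x) x)
    (hg : ∀ x, HasDerivAt g (f' x) x) (h0 : f 0 = g 0) (x : ℝ) : f x = g x := by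
  have hd : ∀ x, HasDerivAt (fun y => f y - g y) 0 x := fun x => by
    have h1 := (hf x).sub (hg x)
    rw [sub_self] at h1
    exact h1
  have := is_const_of_deriv_eq_zero (f := fun y => f y - g y)
    (fun x => (hd x).differentiableAt) (fun x => (hd x).deriv) x 0
  simp only [h0, sub_self] at this
  linarith

lemma hasDerivAt_primitive {f : ℝ → ℝ} (hf : Continuous f) (x : ℝ) :
    HasDerivAt (fun h => ∫ y in (0:ℝ)..h, f y) (f x) x :=
  intervalIntegral.integral_hasDerivAt_right (hf.intervalIntegrable _ _)
    (hf.stronglyMeasurableAtFilter _ _) hf.continuousAt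

lemma Iop_cont {g : ℝ → ℝ} (hg : Continuous g) (p q : ℕ) : Continuous (Iop p g q) := by
  induction q with
  | zero =>
    have : Continuous (fun x : ℝ => x ^ p / (p.factorial : ℝ) * g x) := by fun_prop
    exact continuous_iff_continuousAt.2 (fun x => (hasDerivAt_primitive this x).continuousAt)
  | succ q ih =>
    exact continuous_iff_continuousAt.2 (fun x => (hasDerivAt_primitive ih x).continuousAt)

lemma Iop_zero_deriv {g : ℝ → ℝ} (hg : Continuous g) (p : ℕ) (x : ℝ) :
    HasDerivAt (Iop p g 0) (x ^ p / (p.factorial : ℝ) * g x) x :=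
  hasDerivAt_primitive (f := fun x : ℝ => x ^ p / (p.factorial : ℝ) * g x) (by fun_prop) x

lemma Iop_succ_deriv {g : ℝ → ℝ} (hg : Continuous g) (p q : ℕ) (x : ℝ) :
    HasDerivAt (Iop p g (q + 1)) (Iop p g q x) x :=
  hasDerivAt_primitive (Iop_cont hg p q) x

@[simp] lemma Iop_at_zero (g : ℝ → ℝ) (p q : ℕ) : Iop p g q 0 = 0 := by
  cases q <;> simp [Iop]

lemma Iop_lin {f g : ℝ → ℝ} (hf : Continuous f) (hg : Continuous g) (α β : ℝ) (p q : ℕ) (h : ℝ) :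
    Iop p (fun x => α * f x + β * g x) q h = α * Iop p f q h + β * Iop p g q h := by
  have hc : Continuous (fun x => α * f x + β * g x) := by fun_prop
  induction q generalizing h with
  | zero =>
    refine eq_of_hasDerivAt (g := fun h => α * Iop p f 0 h + β * Iop p g 0 h) (Iop_zero_deriv hc p) (fun x => ?_) (by simp) h
    have := ((Iop_zero_deriv hf p x).const_mul α).add ((Iop_zero_deriv hg p x).const_mul β)
    refine this.congr_deriv ?_
    ring
  | succ q ih =>
    refine eq_of_hasDerivAt (g := fun h => α * Iop p f (q+1) h + β * Iop p g (q+1) h) (Iop_succ_deriv hc p q) (fun x => ?_) (by simp) h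
    have := ((Iop_succ_deriv hf p q x).const_mul α).add ((Iop_succ_deriv hg p q x).const_mul β)
    exact this.congr_deriv (ih x).symm

lemma hasDerivAt_pow_fact (p : ℕ) (x : ℝ) :
    HasDerivAt (fun y : ℝ => y ^ (p + 1) / ((p + 1).factorial : ℝ)) (x ^ p / (p.factorial : ℝ)) x := by
  have := (hasDerivAt_pow (p + 1) x).div_const ((p + 1).factorial : ℝ)
  refine this.congr_deriv ?_
  rw [Nat.factorial_succ]
  have : (p.factorial : ℝ) ≠ 0 := by positivity
  push_cast
  field_simp

/-- relation (C) -/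
lemma Iop_C {g : ℝ → ℝ} (hg : Continuous g) (p q : ℕ) (h : ℝ) :
    (p + 1 : ℝ) * Iop (p + 1) g q h + (q + 1 : ℝ) * Iop p g (q + 1) h = h * Iop p g q h := by
  induction q generalizing h with
  | zero =>
    refine eq_of_hasDerivAt (g := fun h => h * Iop p g 0 h) (fun x => ((Iop_zero_deriv hg (p+1) x).const_mul _).add
      ((Iop_succ_deriv hg p 0 x).const_mul _)) (fun x => ?_) (by simp) h
    refine ((hasDerivAt_id x).mul (Iop_zero_deriv hg p x)).congr_deriv ?_
    have : (p.factorial : ℝ) ≠ 0 := by positivity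
    rw [Nat.factorial_succ]
    push_cast
    field_simp
    simp
    ring
  | succ q ih =>
    refine eq_of_hasDerivAt (g := fun h => h * Iop p g (q+1) h) (fun x => ((Iop_succ_deriv hg (p+1) q x).const_mul _).add
      ((Iop_succ_deriv hg p (q+1) x).const_mul _)) (fun x => ?_) (by simp) h
    refine ((hasDerivAt_id x).mul (Iop_succ_deriv hg p q x)).congr_deriv ?_
    have := ih x
    simp only [id]
    push_cast
    linarith

/-- integration by parts -/
lemma Iop_parts {G : ℝ → ℝ} (hG : Smooth G) (p q : ℕ) (h : ℝ) :
    Iop (p + 1) (deriv G) (q + 1) h = Iop (p + 1) G q h - Iop p G (q + 1) h := by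
  have c1 := hG.continuous
  have c2 := hG.deriv'.continuous
  induction q generalizing h with
  | zero =>
    refine eq_of_hasDerivAt (g := fun h => Iop (p + 1) G 0 h - Iop p G 1 h) (Iop_succ_deriv c2 (p+1) 0) (fun x => ?_) (by simp) h
    refine ((Iop_zero_deriv c1 (p+1) x).sub (Iop_succ_deriv c1 p 0 x)).congr_deriv ?_
    refine eq_of_hasDerivAt (f := fun x => x ^ (p+1) / ((p+1).factorial : ℝ) * G x - Iop p G 0 x) (f' := fun x => x ^ (p+1) / ((p+1).factorial : ℝ) * deriv G x)
      (fun x => ?_) (Iop_zero_deriv c2 (p+1)) (by simp) x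
    have := ((hasDerivAt_pow_fact p x).mul (hG.diff x).hasDerivAt).sub (Iop_zero_deriv c1 p x)
    refine this.congr_deriv ?_
    ring
  | succ q ih =>
    refine eq_of_hasDerivAt (g := fun h => Iop (p + 1) G (q+1) h - Iop p G (q + 1 + 1) h) (Iop_succ_deriv c2 (p+1) (q+1)) (fun x => ?_) (by simp) h
    exact ((Iop_succ_deriv c1 (p+1) q x).sub (Iop_succ_deriv c1 p (q+1) x)).congr_deriv (ih x).symm

lemma Iop_parts_zero {G : ℝ → ℝ} (hG : Smooth G) (p : ℕ) (h : ℝ) :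
    Iop (p + 1) (deriv G) 0 h = h ^ (p+1) / ((p+1).factorial : ℝ) * G h - Iop p G 0 h := by
  have c1 := hG.continuous
  have c2 := hG.deriv'.continuous
  refine eq_of_hasDerivAt (g := fun h => h ^ (p+1) / ((p+1).factorial : ℝ) * G h - Iop p G 0 h) (Iop_zero_deriv c2 (p+1)) (fun x => ?_) (by simp) h
  have := ((hasDerivAt_pow_fact p x).mul (hG.diff x).hasDerivAt).sub (Iop_zero_deriv c1 p x)
  refine this.congr_deriv ?_
  ring

lemma Iop_taylor_zero {G : ℝ → ℝ} (hG : Smooth G) (h0 : G 0 = 0) (h : ℝ) :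
    Iop 0 (deriv G) 0 h = G h := by
  have c2 := hG.deriv'.continuous
  refine eq_of_hasDerivAt (Iop_zero_deriv c2 0) (fun x => ?_) (by simp [h0]) h
  simpa using (hG.diff x).hasDerivAt

lemma Iop_taylor {G : ℝ → ℝ} (hG : Smooth G) (h0 : G 0 = 0) (q : ℕ) (h : ℝ) :
    Iop 0 (deriv G) (q + 1) h = Iop 0 G q h := by
  have c1 := hG.continuous
  have c2 := hG.deriv'.continuous
  induction q generalizing h with
  | zero =>
    refine eq_of_hasDerivAt (Iop_succ_deriv c2 0 0) (fun x => ?_) (by simp) h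
    rw [Iop_taylor_zero hG h0]
    simpa using Iop_zero_deriv c1 0 x
  | succ q ih =>
    refine eq_of_hasDerivAt (Iop_succ_deriv c2 0 (q+1)) (fun x => ?_) (by simp) h
    rw [ih]
    exact Iop_succ_deriv c1 0 q x

lemma peano {F : ℝ → ℝ} (hF : Smooth F) (h : ℝ) (p q : ℕ) (h1 : VanishAtLeast F (q + 1) 0)
    (h2 : VanishAtLeast F p h) :
    Iop p (iteratedDeriv (p + q + 1) F) q h =
      h ^ p / (p.factorial : ℝ) * iteratedDeriv p F h := by
  obtain ⟨s, hs⟩ : ∃ s, s = p + q := ⟨_, rfl⟩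
  induction s generalizing p q with
  | zero =>
    obtain ⟨rfl, rfl⟩ : p = 0 ∧ q = 0 := by omega
    have := h1 0 (by omega)
    simp only [iteratedDeriv_zero] at this
    simpa using Iop_taylor_zero hF this h
  | succ s ih =>
    rw [iteratedDeriv_succ]
    rcases p with _ | p <;> rcases q with _ | q
    · omega
    · rw [Iop_taylor (hF.iter _) (h1 _ (by omega))]
      exact ih 0 q (van_mono h1 (by omega)) (van_zero _ _) (by omega)
    · rw [Iop_parts_zero (hF.iter _)]
      have := ih p 0 h1 (van_mono h2 (by omega)) (by omega)
      rw [h2 p (by omega)] at this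
      have e : p + 1 + 0 = p + 0 + 1 := by omega
      rw [e, this]
      simp
    · rw [Iop_parts (hF.iter _)]
      have a1 := ih p (q+1) h1 (van_mono h2 (by omega)) (by omega)
      have a2 := ih (p+1) q (van_mono h1 (by omega)) h2 (by omega)
      rw [h2 p (by omega)] at a1
      have e1 : p + 1 + (q + 1) = p + (q + 1) + 1 := by omega
      have e2 : p + 1 + (q + 1) = p + 1 + q + 1 := by omega
      rw [← e1] at a1
      rw [← e2] at a2
      rw [a1, a2]; simp

/-! ### The determinants `T` -/

def cc (p q : ℕ) (h : ℝ) : ℝ := Iop p Real.cos q h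
def ss (p q : ℕ) (h : ℝ) : ℝ := Iop p Real.sin q h

lemma cc_C (p q : ℕ) (h : ℝ) :
    (p + 1 : ℝ) * cc (p + 1) q h + (q + 1 : ℝ) * cc p (q + 1) h = h * cc p q h :=
  Iop_C Real.continuous_cos p q h
lemma ss_C (p q : ℕ) (h : ℝ) :
    (p + 1 : ℝ) * ss (p + 1) q h + (q + 1 : ℝ) * ss p (q + 1) h = h * ss p q h :=
  Iop_C Real.continuous_sin p q h

lemma cc_A (p q : ℕ) (h : ℝ) : HasDerivAt (cc p (q + 1)) (cc p q h) h :=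
  Iop_succ_deriv Real.continuous_cos p q h
lemma ss_A (p q : ℕ) (h : ℝ) : HasDerivAt (ss p (q + 1)) (ss p q h) h :=
  Iop_succ_deriv Real.continuous_sin p q h

lemma smooth_cos : Smooth Real.cos := Real.contDiff_cos
lemma smooth_sin : Smooth Real.sin := Real.contDiff_sin

lemma Iop_neg (g : ℝ → ℝ) (hg : Continuous g) (p q : ℕ) (h : ℝ) :
    Iop p (fun x => - g x) q h = - Iop p g q h := by
  have := Iop_lin hg hg (-1) 0 p q h
  simpa using this

lemma cc_D (p q : ℕ) (h : ℝ) : cc (p + 1) q h = - ss (p + 1) (q + 1) h + cc p (q + 1) h := by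
  have := Iop_parts smooth_cos p q h
  rw [Real.deriv_cos', Iop_neg _ Real.continuous_sin] at this
  simp only [cc, ss]; linarith
lemma ss_D (p q : ℕ) (h : ℝ) : ss (p + 1) q h = cc (p + 1) (q + 1) h + ss p (q + 1) h := by
  have := Iop_parts smooth_sin p q h
  rw [Real.deriv_sin] at this
  simp only [cc, ss]; linarith

lemma cc_B (p q : ℕ) (h : ℝ) :
    HasDerivAt (cc (p + 1) q) (- ss (p + 1) q h + cc p q h) h := by
  cases q with
  | zero =>
    refine (Iop_zero_deriv Real.continuous_cos (p+1) h).congr_deriv ?_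
    have := Iop_parts_zero smooth_cos p h
    rw [Real.deriv_cos', Iop_neg _ Real.continuous_sin] at this
    simp only [cc, ss]; linarith
  | succ q => exact (cc_A (p+1) q h).congr_deriv (cc_D p q h)
lemma ss_B (p q : ℕ) (h : ℝ) :
    HasDerivAt (ss (p + 1) q) (cc (p + 1) q h + ss p q h) h := by
  cases q with
  | zero =>
    refine (Iop_zero_deriv Real.continuous_sin (p+1) h).congr_deriv ?_
    have := Iop_parts_zero smooth_sin p h
    rw [Real.deriv_sin] at this
    simp only [cc, ss]; linarith
  | succ q => exact (ss_A (p+1) q h).congr_deriv (ss_D p q h)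

def T (p q : ℕ) (h : ℝ) : ℝ := cc p (q + 1) h * ss (p + 1) q h - ss p (q + 1) h * cc (p + 1) q h
def R (p q : ℕ) (h : ℝ) : ℝ := cc p (q + 1) h * cc (p + 1) q h + ss p (q + 1) h * ss (p + 1) q h

lemma T_deriv (p q : ℕ) (h : ℝ) : ∃ T' : ℝ, HasDerivAt (T p q) T' h ∧
    h * T' = (p + q + 2) * T p q h + h * R p q h := by
  refine ⟨_, ((cc_A p q h).mul (ss_B p q h)).sub ((ss_A p q h).mul (cc_B p q h)), ?_⟩
  have h1 := cc_C p q h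
  have h2 := ss_C p q h
  simp only [T, R]
  linear_combination (ss p (q+1) h - ss (p+1) q h) * h1 + (cc (p+1) q h - cc p (q+1) h) * h2

lemma three_term_T (p q : ℕ) (h : ℝ) : (p + 2 : ℝ) * T (p + 1) q h + (q + 2) * T p (q + 1) h =
    h * (cc (p+1) (q+1) h ^ 2 + ss (p+1) (q+1) h ^ 2) := by
  have a1 := cc_C (p+1) q h
  have a2 := ss_C (p+1) q h
  have b1 := cc_C p (q+1) h
  have b2 := ss_C p (q+1) h
  have d1 := cc_D p q h
  have d2 := ss_D p q h
  simp only [T]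
  push_cast at *
  rw [d1] at a1
  rw [d2] at a2
  linear_combination cc (p+1) (q+1) h * a2 - ss (p+1) (q+1) h * a1 - cc (p+1) (q+1) h * b2
    + ss (p+1) (q+1) h * b1 + (cc (p+1) (q+1) h * (q + 1) * (d2 - d2))

lemma three_term_R (p q : ℕ) (h : ℝ) : (q + 2) * R p (q + 1) h - (p + 2 : ℝ) * R (p + 1) q h =
    (q - p : ℝ) * (cc (p+1) (q+1) h ^ 2 + ss (p+1) (q+1) h ^ 2) := by
  have a1 := cc_C (p+1) q h
  have a2 := ss_C (p+1) q h
  have b1 := cc_C p (q+1) h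
  have b2 := ss_C p (q+1) h
  have d1 := cc_D p q h
  have d2 := ss_D p q h
  simp only [R]
  push_cast at *
  rw [d1] at a1
  rw [d2] at a2
  linear_combination cc (p+1) (q+1) h * b1 + ss (p+1) (q+1) h * b2 - cc (p+1) (q+1) h * a1
    - ss (p+1) (q+1) h * a2

lemma Iop_bound {g : ℝ → ℝ} (hg : ∀ x, |g x| ≤ 1) (p q : ℕ) {h : ℝ} (hh : 0 ≤ h) :
    |Iop p g q h| ≤ h ^ (p + q + 1) := by
  induction q generalizing h with
  | zero =>
    have := intervalIntegral.norm_integral_le_of_norm_le_const (a := 0) (b := h) (C := h ^ p)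
      (f := fun x : ℝ => x ^ p / (p.factorial : ℝ) * g x) (by
        intro x hx
        rw [Set.uIoc_of_le hh] at hx
        have h1 : (1:ℝ) ≤ p.factorial := by exact_mod_cast p.factorial_pos
        rw [norm_mul, norm_div, Real.norm_eq_abs, Real.norm_eq_abs, Real.norm_eq_abs,
          abs_of_nonneg (pow_nonneg hx.1.le p), abs_of_nonneg (by linarith : (0:ℝ) ≤ p.factorial)]
        have h2 : x ^ p / (p.factorial : ℝ) ≤ x ^ p := div_le_self (pow_nonneg hx.1.le p) h1
        have h3 : x ^ p ≤ h ^ p := pow_le_pow_left₀ hx.1.le hx.2 p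
        have h4 : 0 ≤ x ^ p / (p.factorial : ℝ) := div_nonneg (pow_nonneg hx.1.le p) (by linarith)
        nlinarith [hg x, abs_nonneg (g x)])
    rw [sub_zero, abs_of_nonneg hh, ← pow_succ] at this
    exact this
  | succ q ih =>
    have := intervalIntegral.norm_integral_le_of_norm_le_const (a := 0) (b := h)
      (C := h ^ (p + q + 1))
      (f := Iop p g q) (by
        intro x hx
        rw [Set.uIoc_of_le hh] at hx
        exact (ih hx.1.le).trans (pow_le_pow_left₀ hx.1.le hx.2 _))
    rw [sub_zero, abs_of_nonneg hh, ← pow_succ] at this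
    exact this

lemma T_bound (p q : ℕ) {h : ℝ} (hh : 0 ≤ h) : |T p q h| ≤ 2 * (h ^ (p + q + 2)) ^ 2 := by
  have a1 : |cc p (q+1) h| ≤ h ^ (p + q + 2) := Iop_bound Real.abs_cos_le_one p (q+1) hh
  have a2 : |ss p (q+1) h| ≤ h ^ (p + q + 2) := Iop_bound Real.abs_sin_le_one p (q+1) hh
  have e : p + 1 + q + 1 = p + q + 2 := by omega
  have a3 : |cc (p+1) q h| ≤ h ^ (p + q + 2) := e ▸ Iop_bound Real.abs_cos_le_one (p+1) q hh
  have a4 : |ss (p+1) q h| ≤ h ^ (p + q + 2) := e ▸ Iop_bound Real.abs_sin_le_one (p+1) q hh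
  have h0 : 0 ≤ h ^ (p + q + 2) := pow_nonneg hh _
  have m1 := mul_le_mul a1 a4 (abs_nonneg _) h0
  have m2 := mul_le_mul a2 a3 (abs_nonneg _) h0
  rw [← abs_mul] at m1 m2
  simp only [T]
  refine (abs_sub _ _).trans ?_
  nlinarith

/-- Growth lemma. -/
lemma growth {W : ℝ → ℝ} {N : ℕ} {C : ℝ} (hN : 1 ≤ N) (hb : ∀ h, 0 ≤ h → |W h| ≤ C * (h ^ N) ^ 2)
    (hd : ∀ h, 0 < h → ∃ W', HasDerivAt W W' h ∧ N * W h ≤ h * W') {h : ℝ} (hh : 0 < h) :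
    0 ≤ W h := by
  have hderiv : ∀ x, 0 < x → ∃ d, 0 ≤ d ∧ HasDerivAt (fun y => W y / y ^ N) d x := by
    intro x hx
    obtain ⟨W', h1, h2⟩ := hd x hx
    refine ⟨_, ?_, h1.div (hasDerivAt_pow N x) (pow_ne_zero _ hx.ne')⟩
    apply div_nonneg _ (by positivity)
    have e : x ^ N = x ^ (N - 1) * x := by rw [← pow_succ, Nat.sub_add_cancel hN]
    rw [e]
    have : 0 ≤ x ^ (N-1) := by positivity
    nlinarith
  have hW0 : W 0 = 0 := by
    have := hb 0 le_rfl
    rw [zero_pow (by omega)] at this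
    simpa using this
  have hmono : MonotoneOn (fun y => W y / y ^ N) (Set.Ici 0) := by
    apply monotoneOn_of_deriv_nonneg (convex_Ici 0)
    · intro x hx
      rcases eq_or_lt_of_le (Set.mem_Ici.1 hx) with h0 | h0
      · subst h0
        rw [ContinuousWithinAt]
        simp only [hW0, zero_div]
        have hlim : Filter.Tendsto (fun y : ℝ => C * y ^ N) (nhdsWithin 0 (Set.Ici 0)) (nhds 0) := by
          have : Continuous (fun y : ℝ => C * y ^ N) := by fun_prop
          have := this.tendsto 0
          rw [zero_pow (by omega), mul_zero] at this
          exact this.mono_left nhdsWithin_le_nhds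
        apply squeeze_zero_norm' _ hlim
        filter_upwards [self_mem_nhdsWithin] with y hy
        have hy' : 0 ≤ y := hy
        rw [Real.norm_eq_abs, abs_div, abs_of_nonneg (pow_nonneg hy' N)]
        rcases eq_or_lt_of_le hy' with h0 | h0
        · subst h0; rw [zero_pow (by omega)]; simp
        · rw [div_le_iff₀ (by positivity)]
          have := hb y hy'
          nlinarith
      · obtain ⟨d, -, h2⟩ := hderiv x h0
        exact h2.continuousAt.continuousWithinAt
    · intro x hx
      rw [interior_Ici] at hx
      obtain ⟨d, -, h2⟩ := hderiv x hx
      exact h2.differentiableAt.differentiableWithinAt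
    · intro x hx
      rw [interior_Ici] at hx
      obtain ⟨d, h1, h2⟩ := hderiv x hx
      rw [h2.deriv]; exact h1
  have := hmono (Set.mem_Ici.2 le_rfl) (Set.mem_Ici.2 hh.le) hh.le
  simp only [hW0, zero_div] at this
  rw [le_div_iff₀ (by positivity)] at this
  simpa using this

lemma W_nonneg (σ : ℝ) (p q : ℕ) (hpq : 0 ≤ σ * ((q : ℝ) - p)) {h : ℝ} (hh : 0 < h) :
    0 ≤ σ * ((q + 2) * T p (q + 1) h - (p + 2) * T (p + 1) q h) := by
  refine growth (W := fun h => σ * ((q + 2) * T p (q + 1) h - (p + 2) * T (p + 1) q h))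
    (N := p + q + 3) (C := |σ| * ((q + 2) * 2 + (p + 2) * 2)) (by omega) ?_ ?_ hh
  · intro x hx
    have a1 := T_bound p (q+1) hx
    have a2 := T_bound (p+1) q hx
    have e1 : p + (q + 1) + 2 = p + q + 3 := by omega
    have e2 : p + 1 + q + 2 = p + q + 3 := by omega
    rw [e1] at a1
    rw [e2] at a2
    rw [abs_mul, mul_assoc]
    apply mul_le_mul_of_nonneg_left _ (abs_nonneg σ)
    refine (abs_sub _ _).trans ?_
    rw [abs_mul, abs_mul, abs_of_nonneg (by positivity : (0:ℝ) ≤ (q:ℝ) + 2),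
      abs_of_nonneg (by positivity : (0:ℝ) ≤ (p:ℝ) + 2)]
    have b1 := mul_le_mul_of_nonneg_left a1 (by positivity : (0:ℝ) ≤ (q:ℝ) + 2)
    have b2 := mul_le_mul_of_nonneg_left a2 (by positivity : (0:ℝ) ≤ (p:ℝ) + 2)
    linarith
  · intro x hx
    obtain ⟨T1, h1, h2⟩ := T_deriv p (q+1) x
    obtain ⟨T2, h3, h4⟩ := T_deriv (p+1) q x
    refine ⟨_, ((h1.const_mul _).sub (h3.const_mul _)).const_mul σ, ?_⟩
    have h5 := three_term_R p q x
    have h6 : 0 ≤ (σ * ((q : ℝ) - p)) * (x * (cc (p+1) (q+1) x ^ 2 + ss (p+1) (q+1) x ^ 2)) := by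
      positivity
    push_cast at *
    have : x * (σ * ((↑q + 2) * T1 - (↑p + 2) * T2)) =
      (p + q + 3) * (σ * ((q + 2) * T p (q + 1) x - (p + 2) * T (p + 1) q x)) +
      (σ * ((q : ℝ) - p)) * (x * (cc (p+1) (q+1) x ^ 2 + ss (p+1) (q+1) x ^ 2)) := by
      linear_combination σ * (q + 2) * h2 - σ * (p+2) * h4 + σ * x * h5
    linarith

lemma T_pos (d : ℕ) : ∀ (p : ℕ) {h : ℝ}, 0 < h →
    0 < cc (p + 1 + d) (p + 1 + d) h ^ 2 + ss (p + 1 + d) (p + 1 + d) h ^ 2 →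
    0 < T p (p + 1 + 2 * d) h := by
  induction d with
  | zero =>
    intro p h hh hpos
    have h1 := three_term_T p p h
    have h2 := W_nonneg 1 p p (by simp) hh
    have h4 := mul_pos hh hpos
    simp only [add_zero] at h4
    rw [← h1] at h4
    simp only [mul_zero, add_zero]
    by_contra hc
    push Not at hc
    have : (0:ℝ) < p + 2 := by positivity
    nlinarith
  | succ d ih =>
    intro p h hh hpos
    have e : p + 1 + 1 + d = p + 1 + (d + 1) := by omega
    have h1 := ih (p+1) hh (by rw [e]; exact hpos)
    have h2 := W_nonneg 1 p (p + 1 + 2 * d + 1) (by push_cast; nlinarith [(Nat.cast_nonneg d : (0:ℝ) ≤ d)]) hh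
    have e2 : p + 1 + 1 + 2 * d = p + 1 + 2 * d + 1 := by omega
    have e3 : p + 1 + 2 * (d + 1) = p + 1 + 2 * d + 1 + 1 := by omega
    rw [e2] at h1
    rw [e3]
    set t1 := T p (p + 1 + 2 * d + 1 + 1) h
    set t2 := T (p+1) (p + 1 + 2 * d + 1) h
    have h3 : 0 < ((p:ℝ) + 2) * t2 := by positivity
    by_contra hc
    push Not at hc
    have : (0:ℝ) < ((p + 1 + 2 * d + 1 : ℕ) : ℝ) + 2 := by positivity
    nlinarith

lemma ss_pos (q : ℕ) {h : ℝ} (hh : 0 < h) : 0 < ss 0 (q + 1) h := by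
  have h0 : ∀ x, ss 0 0 x = 1 - Real.cos x := by
    intro x
    refine eq_of_hasDerivAt (g := fun x => 1 - Real.cos x) (f' := Real.sin) (fun y => ?_) (fun y => ?_) (by simp [ss]) x
    · refine (Iop_zero_deriv Real.continuous_sin 0 y).congr_deriv ?_
      simp
    · simpa using (Real.hasDerivAt_cos y).const_sub 1
  have h1 : ∀ x, ss 0 1 x = x - Real.sin x := by
    intro x
    refine eq_of_hasDerivAt (g := fun x => x - Real.sin x) (f' := fun x => 1 - Real.cos x) (fun y => ?_) (fun y => ?_) (by simp [ss]) x
    · have := ss_A 0 0 y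
      rwa [h0] at this
    · exact (hasDerivAt_id y).sub (Real.hasDerivAt_sin y)
  induction q generalizing h with
  | zero => rw [zero_add, h1]; linarith [Real.sin_lt hh]
  | succ q ih =>
    have : StrictMonoOn (ss 0 (q + 1 + 1)) (Set.Ici 0) := by
      apply strictMonoOn_of_deriv_pos (convex_Ici 0)
      · exact (Iop_cont Real.continuous_sin _ _).continuousOn
      · intro x hx
        rw [interior_Ici] at hx
        rw [(ss_A 0 (q+1) x).deriv]
        exact ih hx
    have := this (Set.mem_Ici.2 le_rfl) (Set.mem_Ici.2 hh.le) hh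
    simpa [ss] using this

/-! ### The kernels -/

def Ker (m : ℕ) (F : ℝ → ℝ) : Prop :=
  Smooth F ∧ ∀ x, iteratedDeriv (m + 2) F x + iteratedDeriv m F x = 0

lemma ker_iff (m : ℕ) (F : ℝ → ℝ) : F ∈ kerOp (m + 1) (trigCoeff (m + 1)) ↔ Ker m F := by
  simp only [kerOp, Ker, Set.mem_ofPred_eq, trigCoeff]
  refine and_congr Iff.rfl (forall_congr' fun x => ?_)
  have : ∑ i : Fin (m + 1 + 1), (if (i : ℕ) = m + 1 - 1 then (1:ℝ) else 0) * iteratedDeriv (i : ℕ) F x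
      = iteratedDeriv m F x := by
    rw [Finset.sum_eq_single (⟨m, by omega⟩ : Fin (m + 1 + 1))]
    · simp
    · intro b _ hb
      have : (b : ℕ) ≠ m := fun h => hb (Fin.ext h)
      simp [this]
    · simp
  rw [this]

lemma osc {g : ℝ → ℝ} (hg : Smooth g) (h : ∀ x, deriv (deriv g) x + g x = 0) {x0 : ℝ}
    (h0 : g x0 = 0) (h1 : deriv g x0 = 0) : g = 0 := by
  have hd : ∀ x, HasDerivAt (fun y => g y ^ 2 + deriv g y ^ 2) 0 x := by
    intro x
    have := ((hg.diff x).hasDerivAt.pow 2).add ((hg.deriv'.diff x).hasDerivAt.pow 2)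
    refine this.congr_deriv ?_
    have e : deriv (deriv g) x = - g x := by linarith [h x]
    rw [e]; simp; ring
  ext y
  have := is_const_of_deriv_eq_zero (f := fun y => g y ^ 2 + deriv g y ^ 2)
    (fun x => (hd x).differentiableAt) (fun x => (hd x).deriv) y x0
  simp only [h0, h1] at this
  have : g y ^ 2 = 0 := by nlinarith [sq_nonneg (g y), sq_nonneg (deriv g y)]
  simpa using this

lemma ker_repr {m : ℕ} {F : ℝ → ℝ} (hF : Ker m F) : iteratedDeriv m F =
    fun x => iteratedDeriv m F 0 * Real.cos x + iteratedDeriv (m + 1) F 0 * Real.sin x := by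
  set α := iteratedDeriv m F 0 with hα
  set β := iteratedDeriv (m + 1) F 0 with hβ
  have hs := hF.1.iter m
  have hc : Smooth (fun x => α * Real.cos x + β * Real.sin x) :=
    (contDiff_const.mul smooth_cos).add (contDiff_const.mul smooth_sin)
  have hd : ∀ x, HasDerivAt (fun x => iteratedDeriv m F x - (α * Real.cos x + β * Real.sin x))
      (iteratedDeriv (m+1) F x - (α * (- Real.sin x) + β * Real.cos x)) x := by
    intro x
    have := (hs.diff x).hasDerivAt
    rw [← iteratedDeriv_succ] at this
    exact this.sub (((Real.hasDerivAt_cos x).const_mul α).add ((Real.hasDerivAt_sin x).const_mul β))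
  have e1 : deriv (fun x => iteratedDeriv m F x - (α * Real.cos x + β * Real.sin x)) =
    fun x => (iteratedDeriv (m+1) F x - (α * (- Real.sin x) + β * Real.cos x)) :=
    funext fun x => (hd x).deriv
  have hd2 : ∀ x, HasDerivAt (fun x => iteratedDeriv (m+1) F x - (α * (- Real.sin x) + β * Real.cos x))
      (iteratedDeriv (m+2) F x - (α * (- Real.cos x) + β * (- Real.sin x))) x := by
    intro x
    have := ((hF.1.iter (m+1)).diff x).hasDerivAt
    rw [← iteratedDeriv_succ] at this
    exact this.sub (((Real.hasDerivAt_sin x).neg.const_mul α).add ((Real.hasDerivAt_cos x).const_mul β))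
  have := osc (hs.sub hc) (x0 := 0) (fun x => by
    rw [e1, (hd2 x).deriv]
    have := hF.2 x
    linarith) (by simp [hα]) (by rw [e1]; simp [hβ])
  ext x
  have := congrFun this x
  simp only [Pi.zero_apply] at this
  linarith

lemma hasZeros_two {F : ℝ → ℝ} {J : Set ℝ} {a b : ℝ} (hab : a ≠ b) (ha : a ∈ J) (hb : b ∈ J)
    {i j : ℕ} (h1 : VanishAtLeast F i a) (h2 : VanishAtLeast F j b) : HasZeros F J (i + j) := by
  classical
  refine ⟨{a, b}, fun x => if x = a then i else j, ?_, ?_, ?_⟩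
  · intro x hx
    simp only [Finset.mem_insert, Finset.mem_singleton] at hx
    rcases hx with rfl | rfl <;> assumption
  · intro x hx
    simp only [Finset.mem_insert, Finset.mem_singleton] at hx
    rcases hx with rfl | rfl
    · simpa using h1
    · simpa [hab.symm] using h2
  · rw [Finset.sum_pair hab]; simp [hab.symm]

lemma hasZeros_mono {F : ℝ → ℝ} {J : Set ℝ} {N M : ℕ} (h : HasZeros F J N) (hM : M ≤ N) :
    HasZeros F J M := by
  obtain ⟨s, m, h1, h2, h3⟩ := h
  exact ⟨s, m, h1, h2, by omega⟩

lemma cc00 (x : ℝ) : cc 0 0 x = Real.sin x := by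
  refine eq_of_hasDerivAt (f' := Real.cos) (fun y => ?_) Real.hasDerivAt_sin (by simp [cc]) x
  refine (Iop_zero_deriv Real.continuous_cos 0 y).congr_deriv ?_
  simp

lemma ss00 (x : ℝ) : ss 0 0 x = 1 - Real.cos x := by
  refine eq_of_hasDerivAt (g := fun x => 1 - Real.cos x) (f' := Real.sin) (fun y => ?_)
    (fun y => ?_) (by simp [ss]) x
  · refine (Iop_zero_deriv Real.continuous_sin 0 y).congr_deriv ?_
    simp
  · simpa using (Real.hasDerivAt_cos y).const_sub 1

lemma good1 {k : ℕ} {F : ℝ → ℝ} (hF : Ker (2 * k + 1) F) {h : ℝ} (hh : 0 < h)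
    (hpos : 0 < cc k k h ^ 2 + ss k k h ^ 2) {i j : ℕ} (hij : i + j = 2 * k + 3) (hi : k + 2 ≤ i)
    (h1 : VanishAtLeast F i 0) (h2 : VanishAtLeast F j h) : F = 0 := by
  have hz : HasZeros F Set.univ (2 * k + 1) :=
    hasZeros_mono (hasZeros_two hh.ne (Set.mem_univ _) (Set.mem_univ _) h1 h2) (by omega)
  apply poly_zero _ hF.1 _ hz
  have hr := ker_repr hF
  set α := iteratedDeriv (2 * k + 1) F 0 with hα
  set β := iteratedDeriv (2 * k + 1 + 1) F 0 with hβ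
  suffices α = 0 ∧ β = 0 by
    rw [hr, this.1, this.2]; ext x; simp
  have hI : ∀ p q, Iop p (iteratedDeriv (2 * k + 1) F) q h = α * cc p q h + β * ss p q h := by
    intro p q
    rw [hr]
    exact Iop_lin Real.continuous_cos Real.continuous_sin α β p q h
  rcases j with _ | _ | p
  · exact ⟨h1 _ (by omega), h1 _ (by omega)⟩
  · have hα0 : α = 0 := h1 _ (by omega)
    refine ⟨hα0, ?_⟩
    have h3 := peano hF.1 h 0 (2 * k) (van_mono h1 (by omega)) (van_zero _ _)
    rw [zero_add, hI, hα0, h2 0 (by omega)] at h3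
    have : ss 0 (2 * k) h ≠ 0 := by
      rcases k with _ | k
      · simp only [mul_zero]
        intro h0
        rw [h0, cc00] at hpos
        rw [ss00] at h0
        nlinarith [Real.sin_sq_add_cos_sq h]
      · exact (ss_pos (2 * k + 1) hh).ne'
    simpa [this] using h3
  · obtain ⟨d, rfl⟩ : ∃ d, k = p + 1 + d := ⟨k - p - 1, by omega⟩
    have hi' : i = p + 1 + 2 * d + 2 := by omega
    subst hi'
    have a1 := peano hF.1 h (p+1) (p + 1 + 2 * d) (van_mono h1 (by omega)) (van_mono h2 (by omega))
    have a2 := peano hF.1 h p (p + 1 + 2 * d + 1) (van_mono h1 (by omega)) (van_mono h2 (by omega))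
    have e1 : p + 1 + (p + 1 + 2 * d) + 1 = 2 * (p + 1 + d) + 1 := by omega
    have e2 : p + (p + 1 + 2 * d + 1) + 1 = 2 * (p + 1 + d) + 1 := by omega
    rw [e1, hI, h2 _ (by omega), mul_zero] at a1
    rw [e2, hI, h2 _ (by omega), mul_zero] at a2
    have hT := T_pos d p hh hpos
    simp only [T] at hT
    constructor
    · have : α * (cc p (p + 1 + 2 * d + 1) h * ss (p + 1) (p + 1 + 2 * d) h -
        ss p (p + 1 + 2 * d + 1) h * cc (p + 1) (p + 1 + 2 * d) h) = 0 := by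
        linear_combination ss (p + 1) (p + 1 + 2 * d) h * a2 - ss p (p + 1 + 2 * d + 1) h * a1
      exact (mul_eq_zero.1 this).resolve_right hT.ne'
    · have : β * (cc p (p + 1 + 2 * d + 1) h * ss (p + 1) (p + 1 + 2 * d) h -
        ss p (p + 1 + 2 * d + 1) h * cc (p + 1) (p + 1 + 2 * d) h) = 0 := by
        linear_combination cc p (p + 1 + 2 * d + 1) h * a1 - cc (p+1) (p + 1 + 2 * d) h * a2
      exact (mul_eq_zero.1 this).resolve_right hT.ne'

lemma iter_refl (F : ℝ → ℝ) (h : ℝ) (hF : Smooth F) (n : ℕ) :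
    iteratedDeriv n (fun x => F (h - x)) = fun x => (-1) ^ n * iteratedDeriv n F (h - x) := by
  have := iteratedDeriv_comp_const_sub (n := n) (f := F) (s := h)
  simpa [smul_eq_mul] using this

lemma good {k : ℕ} {F : ℝ → ℝ} (hF : Ker (2 * k + 1) F) {h : ℝ} (hh : 0 < h)
    (hpos : 0 < cc k k h ^ 2 + ss k k h ^ 2) {i j : ℕ} (hij : i + j = 2 * k + 3)
    (h1 : VanishAtLeast F i 0) (h2 : VanishAtLeast F j h) : F = 0 := by
  rcases le_or_gt (k + 2) i with hi | hi
  · exact good1 hF hh hpos hij hi h1 h2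
  · have hs : Smooth (fun x => F (h - x)) := hF.1.comp (contDiff_const.sub contDiff_id)
    have := good1 (k := k) (F := fun x => F (h - x)) ⟨hs, fun x => by
      rw [iter_refl F h hF.1, iter_refl F h hF.1]
      have := hF.2 (h - x)
      simp only
      rw [pow_add]
      linear_combination (-1) ^ (2 * k + 1) * this⟩ hh hpos (i := j) (j := i) (by omega) (by omega)
      (fun s hs' => by rw [iter_refl F h hF.1]; simp [h2 s hs'])
      (fun s hs' => by rw [iter_refl F h hF.1]; simp [h1 s hs'])
    ext x
    have := congrFun this (h - x)
    simpa using this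

/-! ### Canonical basis -/

def Sf : ℕ → ℝ → ℝ
  | 0 => Real.cos
  | m + 1 => fun x => ∫ y in (0:ℝ)..x, Sf m y

lemma Sf_smooth (m : ℕ) : Smooth (Sf m) ∧ deriv (Sf (m + 1)) = Sf m := by
  have key : ∀ m, Smooth (Sf m) → deriv (Sf (m + 1)) = Sf m := fun m h => by
    ext x; exact (hasDerivAt_primitive h.continuous x).deriv
  have h : ∀ m, Smooth (Sf m) := by
    intro m
    induction m with
    | zero => exact smooth_cos
    | succ m ih =>
      refine contDiff_infty_iff_deriv.2 ⟨fun x => (hasDerivAt_primitive ih.continuous x).differentiableAt, ?_⟩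
      rw [key m ih]; exact ih
  exact ⟨h m, key m (h m)⟩

lemma Sf_van (m : ℕ) : VanishAtLeast (Sf m) m 0 := by
  induction m with
  | zero => exact van_zero _ _
  | succ m ih =>
    rw [van_succ, (Sf_smooth m).2]
    exact ⟨by simp [Sf], ih⟩

lemma Sf_iter (m s : ℕ) : iteratedDeriv (m + s) (Sf m) = iteratedDeriv s Real.cos := by
  induction m with
  | zero => simp [Sf]
  | succ m ih => rw [show m + 1 + s = m + s + 1 by omega, iteratedDeriv_succ', (Sf_smooth m).2, ih]

lemma Sf_lead (m : ℕ) : iteratedDeriv m (Sf m) 0 = 1 := by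
  have := Sf_iter m 0
  rw [add_zero] at this
  rw [this]; simp

lemma Sf_ker {m r : ℕ} (hr : r ≤ m + 1) : Ker m (Sf r) := by
  refine ⟨(Sf_smooth r).1, fun x => ?_⟩
  rcases Nat.lt_or_ge m r with h | h
  · obtain rfl : r = m + 1 := by omega
    rw [show m + 2 = m + 1 + 1 by omega, Sf_iter (m+1) 1]
    have : iteratedDeriv m (Sf (m+1)) = Sf 1 := by
      clear x h hr
      induction m with
      | zero => simp
      | succ m ih => rw [iteratedDeriv_succ', (Sf_smooth _).2, ih]
    rw [this]
    simp [Sf]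
  · obtain ⟨s, rfl⟩ := Nat.exists_eq_add_of_le h
    rw [add_assoc, Sf_iter, Sf_iter, iteratedDeriv_succ', iteratedDeriv_succ']
    simp [Real.deriv_cos']

def us (n : ℕ) : ℕ → ℝ → ℝ := fun r => Sf (n - r)

lemma us_smooth (n r : ℕ) : Smooth (us n r) := (Sf_smooth _).1

lemma iter_lc {u : ℕ → ℝ → ℝ} (hu : ∀ r, Smooth (u r)) (c : ℕ → ℝ) (j s : ℕ) :
    iteratedDeriv s (lc u c j) = lc (fun r => iteratedDeriv s (u r)) c j := by
  induction s with
  | zero => simp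
  | succ s ih =>
    rw [iteratedDeriv_succ, ih, deriv_lc (fun r => (hu r).iter s)]
    simp only [iteratedDeriv_succ]

lemma lc_ker (m : ℕ) (c : ℕ → ℝ) (j : ℕ) : Ker m (lc (us (m+1)) c j) := by
  refine ⟨lc_smooth (us_smooth _) c j, fun x => ?_⟩
  rw [iter_lc (us_smooth _), iter_lc (us_smooth _)]
  simp only [lc, ← Finset.sum_add_distrib, ← mul_add]
  apply Finset.sum_eq_zero
  intro r _
  rw [us, (Sf_ker (m := m) (r := m + 1 - r) (by omega)).2 x, mul_zero]

lemma lc_van (n : ℕ) (c : ℕ → ℝ) (j : ℕ) : VanishAtLeast (lc (us n) c j) (n + 1 - j) 0 := by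
  intro s hs
  rw [iter_lc (us_smooth _)]
  simp only [lc]
  apply Finset.sum_eq_zero
  intro r hr
  rw [Finset.mem_range] at hr
  rw [us, Sf_van (n - r) s (by omega), mul_zero]

lemma lc_succ_last (u : ℕ → ℝ → ℝ) (c : ℕ → ℝ) (j : ℕ) (x : ℝ) :
    lc u c (j + 1) x = lc u c j x + c j * u j x := by
  simp [lc, Finset.sum_range_succ]

lemma lc_indep (n : ℕ) (c : ℕ → ℝ) (j : ℕ) (hj : j ≤ n + 1) (h : lc (us n) c j = 0) :
    ∀ r < j, c r = 0 := by
  induction j with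
  | zero => intro r hr; omega
  | succ j ih =>
    have h1 : iteratedDeriv (n - j) (lc (us n) c (j+1)) 0 = 0 := by
      rw [h]; simp
    rw [iter_lc (us_smooth _), lc_succ_last, ← iter_lc (us_smooth _),
      lc_van n c j (n - j) (by omega), us, Sf_lead] at h1
    have hc : c j = 0 := by linarith
    intro r hr
    rcases Nat.lt_succ_iff_lt_or_eq.1 hr with h' | rfl
    · refine ih (by omega) ?_ r h'
      ext x
      have := congrFun h x
      rw [lc_succ_last, hc] at this
      simpa using this
    · exact hc

lemma lc_repr (m : ℕ) (j : ℕ) : ∀ F, Ker m F → VanishAtLeast F (m + 2 - j) 0 → j ≤ m + 2 →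
    ∃ c, F = lc (us (m+1)) c j := by
  induction j with
  | zero =>
    intro F hF h0 _
    refine ⟨0, ?_⟩
    have hr := ker_repr hF
    rw [h0 m (by omega), h0 (m+1) (by omega)] at hr
    have hz : HasZeros F Set.univ m := ⟨{0}, fun _ => m, by simp, by
      simpa using van_mono h0 (by omega), by simp⟩
    rw [poly_zero m hF.1 (by rw [hr]; ext x; simp) hz]
    ext x; simp [lc]
  | succ j ih =>
    intro F hF h0 hj
    set a := iteratedDeriv (m + 1 - j) F 0 with ha
    have hsm : Smooth (fun x => a * Sf (m + 1 - j) x) := contDiff_const.mul (Sf_smooth _).1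
    have hit : ∀ s x, iteratedDeriv s (fun x => F x - a * Sf (m + 1 - j) x) x =
        iteratedDeriv s F x - a * iteratedDeriv s (Sf (m + 1 - j)) x := by
      intro s
      induction s with
      | zero => intro x; simp
      | succ s ih =>
        intro x
        rw [iteratedDeriv_succ, iteratedDeriv_succ, iteratedDeriv_succ, funext ih]
        exact (((hF.1.iter s).diff x).hasDerivAt.sub
          ((((Sf_smooth _).1.iter s).diff x).hasDerivAt.const_mul a)).deriv
    have hk := Sf_ker (m := m) (r := m + 1 - j) (by omega)
    obtain ⟨c, hc⟩ := ih (fun x => F x - a * Sf (m + 1 - j) x) ⟨hF.1.sub hsm, fun x => by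
      rw [hit, hit]
      linear_combination hF.2 x - a * hk.2 x⟩ (by
        intro s hs
        rw [hit]
        rcases Nat.lt_or_ge s (m + 1 - j) with h | h
        · rw [h0 s (by omega), Sf_van _ s h]; ring
        · obtain rfl : s = m + 1 - j := by omega
          rw [Sf_lead, ← ha]; ring) (by omega)
    refine ⟨Function.update c j a, ?_⟩
    ext x
    have h1 := congrFun hc x
    rw [lc_succ_last]
    have h2 : lc (us (m+1)) (Function.update c j a) j x = lc (us (m+1)) c j x := by
      simp only [lc]
      apply Finset.sum_congr rfl
      intro r hr
      rw [Function.update_of_ne (Finset.mem_range.1 hr).ne]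
    rw [h2, ← h1]
    simp [us]

theorem EC_even {k : ℕ} {h0 h : ℝ} (H : ∀ x, 0 < x → x < h0 → 0 < cc k k x ^ 2 + ss k k x ^ 2)
    (hh : h < h0) {F : ℝ → ℝ} (hF : Ker (2 * k + 1) F)
    (hz : HasZeros F (Set.Icc 0 h) (2 * k + 3)) : F = 0 := by
  classical
  obtain ⟨s, m, hs, hv, hN⟩ := hz
  obtain ⟨i, hi, hvi, hsum⟩ : ∃ i ≤ 2 * k + 3, VanishAtLeast F i 0 ∧
      HasZeros F (Set.Ioo 0 h0) (2 * k + 3 - i) := by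
    have hsub : ∀ x ∈ s.erase 0, x ∈ Set.Ioo 0 h0 := by
      intro x hx
      have h1 := Finset.mem_erase.1 hx
      have h2 := hs x h1.2
      exact ⟨lt_of_le_of_ne h2.1 h1.1.symm, h2.2.trans_lt hh⟩
    by_cases h0s : (0:ℝ) ∈ s
    · have e := Finset.add_sum_erase s m h0s
      refine ⟨min (m 0) (2 * k + 3), min_le_right _ _, van_mono (hv 0 h0s) (min_le_left _ _),
        s.erase 0, m, hsub, fun x hx => hv x (Finset.mem_of_mem_erase hx), ?_⟩
      omega
    · refine ⟨0, by omega, van_zero _ _, s, m, ?_, hv, by omega⟩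
      rwa [Finset.erase_eq_of_notMem h0s] at hsub
  obtain ⟨c, rfl⟩ := lc_repr (2 * k + 1) (2 * k + 3 - i) F hF (van_mono hvi (by omega)) (by omega)
  have h1 := flag Set.ordConnected_Ioo (2 * k + 3 - i) (us (2 * k + 1 + 1)) (us_smooth _) (by
    intro x hx j hj c hvx
    apply lc_indep (2 * k + 1 + 1) c j (by omega)
    exact good (lc_ker (2 * k + 1) c j) hx.1 (H x hx.1 hx.2)
      (i := 2 * k + 1 + 1 + 1 - j) (j := j) (by omega) (lc_van _ c j) hvx) c hsum
  ext x
  simp only [lc, Pi.zero_apply]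
  exact Finset.sum_eq_zero (fun r hr => by rw [h1 r (Finset.mem_range.1 hr), zero_mul])

theorem EC_odd {k : ℕ} {h0 h : ℝ} (H : ∀ x, 0 < x → x < h0 → 0 < cc k k x ^ 2 + ss k k x ^ 2)
    (hh : h < h0) {F : ℝ → ℝ} (hF : Ker (2 * k + 2) F)
    (hz : HasZeros F (Set.Icc 0 h) (2 * k + 4)) : F = 0 := by
  have h1 := EC_even H hh (F := deriv F) ⟨hF.1.deriv', fun x => by
    rw [← iteratedDeriv_succ', ← iteratedDeriv_succ']; exact hF.2 x⟩
    (hasZeros_deriv Set.ordConnected_Icc hF.1 hz)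
  obtain ⟨x, -, hx⟩ := hasZeros_pt hz
  exact eq_zero_of_deriv_zero hF.1 h1 hx

lemma exists_van (m j : ℕ) (hj : j + 1 ≤ m + 2) (h : ℝ) : ∃ F, F ≠ 0 ∧ Ker m F ∧
    VanishAtLeast F (m + 1 - j) 0 ∧ VanishAtLeast F j h := by
  let A : (Fin (j+1) → ℝ) →ₗ[ℝ] (Fin j → ℝ) :=
    Matrix.toLin' (Matrix.of fun (s : Fin j) (r : Fin (j+1)) => iteratedDeriv (s : ℕ) (us (m+1) r) h)
  obtain ⟨v, hv, hv0⟩ : ∃ v, A v = 0 ∧ v ≠ 0 := by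
    have := LinearMap.ker_ne_bot_of_finrank_lt (f := A) (by simp)
    obtain ⟨v, hv, hv0⟩ := (Submodule.ne_bot_iff _).1 this
    exact ⟨v, hv, hv0⟩
  let c : ℕ → ℝ := fun r => if hr : r < j + 1 then v ⟨r, hr⟩ else 0
  refine ⟨lc (us (m+1)) c (j+1), ?_, lc_ker m c (j+1), ?_, ?_⟩
  · intro h0
    apply hv0
    ext r
    have := lc_indep (m+1) c (j+1) (by omega) h0 r r.2
    exact (by simpa [c] using this : (r : ℕ) ≤ j → v r = 0) (Nat.lt_succ_iff.1 r.2)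
  · exact van_mono (lc_van (m+1) c (j+1)) (by omega)
  · intro s hs
    rw [iter_lc (us_smooth _)]
    have := congrFun hv ⟨s, hs⟩
    simp only [A, Matrix.toLin'_apply, Matrix.mulVec, dotProduct, Matrix.of_apply] at this
    simp only [lc]
    rw [Finset.sum_range]
    rw [Pi.zero_apply] at this
    rw [← this]
    apply Finset.sum_congr rfl
    intro r _
    simp only [c, r.2, dif_pos]
    ring

lemma bad_even {k : ℕ} {h : ℝ} (hh : 0 < h) (hc : cc k k h = 0) (hs : ss k k h = 0) :
    ∃ F, F ≠ 0 ∧ Ker (2 * k + 1) F ∧ VanishAtLeast F (k + 2) 0 ∧ VanishAtLeast F (k + 1) h := by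
  obtain ⟨F, h1, h2, h3, h4⟩ := exists_van (2 * k + 1) k (by omega) h
  refine ⟨F, h1, h2, van_mono h3 (by omega), ?_⟩
  have hp := peano h2.1 h k k (van_mono h3 (by omega)) h4
  rw [show k + k + 1 = 2 * k + 1 by omega, ker_repr h2,
    Iop_lin Real.continuous_cos Real.continuous_sin] at hp
  rw [show Iop k Real.cos k h = 0 from hc, show Iop k Real.sin k h = 0 from hs] at hp
  have : h ^ k / (k.factorial : ℝ) ≠ 0 := by positivity
  have h0 : iteratedDeriv k F h = 0 := by
    rcases mul_eq_zero.1 (by linarith : h ^ k / (k.factorial : ℝ) * iteratedDeriv k F h = 0) with h | h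
    · exact absurd h this
    · exact h
  intro s hs
  rcases Nat.lt_succ_iff_lt_or_eq.1 hs with h' | rfl
  · exact h4 s h'
  · exact h0

lemma bad_odd {k : ℕ} {h : ℝ} (hh : 0 < h) (hc : cc k k h = 0) (hs : ss k k h = 0) :
    ∃ F, F ≠ 0 ∧ Ker (2 * k + 2) F ∧ VanishAtLeast F (k + 2) 0 ∧ VanishAtLeast F (k + 2) h := by
  obtain ⟨F, h1, h2, h3, h4⟩ := exists_van (2 * k + 2) (k + 1) (by omega) h
  refine ⟨F, h1, h2, van_mono h3 (by omega), ?_⟩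
  have hp := peano h2.1 h (k+1) k (van_mono h3 (by omega)) h4
  have hq := peano h2.1 h k (k+1) (van_mono h3 (by omega)) (van_mono h4 (by omega))
  have hC := Iop_C (h2.1.iter (2 * k + 2)).continuous k k h
  have hz : Iop k (iteratedDeriv (2 * k + 2) F) k h = 0 := by
    rw [ker_repr h2, Iop_lin Real.continuous_cos Real.continuous_sin]
    rw [show Iop k Real.cos k h = 0 from hc, show Iop k Real.sin k h = 0 from hs]; ring
  rw [show k + 1 + k + 1 = 2 * k + 2 by omega] at hp
  rw [show k + (k + 1) + 1 = 2 * k + 2 by omega, h4 k (by omega), mul_zero] at hq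
  rw [hz, hq, hp] at hC
  have : h ^ (k+1) / ((k+1).factorial : ℝ) ≠ 0 := by positivity
  have h0 : iteratedDeriv (k+1) F h = 0 := by
    have hk : (k + 1 : ℝ) ≠ 0 := by positivity
    have e : ((k + 1 : ℝ) * (h ^ (k+1) / ((k+1).factorial : ℝ))) * iteratedDeriv (k+1) F h = 0 := by
      linarith
    exact (mul_eq_zero.1 e).resolve_left (mul_ne_zero hk this)
  intro s hs
  rcases Nat.lt_succ_iff_lt_or_eq.1 hs with h' | rfl
  · exact h4 s h'
  · exact h0

/-! ### The functions `Bk` (spherical Bessel functions) -/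

def Bk : ℕ → ℝ → ℝ
  | 0 => Real.sin
  | 1 => fun x => Real.sin x - x * Real.cos x
  | k + 2 => fun x => (2 * k + 3) * Bk (k + 1) x - x ^ 2 * Bk k x

lemma Bk_rec (k : ℕ) (x : ℝ) : Bk (k + 2) x = (2 * k + 3) * Bk (k + 1) x - x ^ 2 * Bk k x := rfl

lemma Bk_deriv_step (k : ℕ) (x b : ℝ) (h1 : HasDerivAt (Bk (k + 1)) (x * Bk k x) x)
    (h0 : HasDerivAt (Bk k) b x) (hb : (2 * k + 1) * Bk k x - x * b = Bk (k + 1) x) :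
    HasDerivAt (Bk (k + 2)) (x * Bk (k + 1) x) x := by
  have h3 := (h1.const_mul (2 * k + 3 : ℝ)).sub (((hasDerivAt_id x).pow 2).mul h0)
  refine h3.congr_deriv ?_
  simp
  linear_combination x * hb

lemma Bk_deriv_aux (k : ℕ) (x : ℝ) : HasDerivAt (Bk (k + 1)) (x * Bk k x) x ∧
    HasDerivAt (Bk (k + 2)) (x * Bk (k + 1) x) x := by
  induction k with
  | zero =>
    have h1 : HasDerivAt (Bk (0 + 1)) (x * Bk 0 x) x := by
      have := (Real.hasDerivAt_sin x).sub ((hasDerivAt_id x).mul (Real.hasDerivAt_cos x))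
      refine (this.congr_deriv ?_)
      simp [Bk]
    refine ⟨h1, Bk_deriv_step 0 x (Real.cos x) h1 (Real.hasDerivAt_sin x) ?_⟩
    simp [Bk]
  | succ k ih =>
    refine ⟨ih.2, Bk_deriv_step (k + 1) x _ ih.2 ih.1 ?_⟩
    rw [Bk_rec]; push_cast
    ring

lemma Bk_deriv (k : ℕ) (x : ℝ) : HasDerivAt (Bk (k + 1)) (x * Bk k x) x := (Bk_deriv_aux k x).1

/-- the other derivative formula -/
lemma Bk_deriv2 (k : ℕ) (x : ℝ) : ∃ b, HasDerivAt (Bk k) b x ∧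
    (2 * k + 1) * Bk k x - x * b = Bk (k + 1) x := by
  cases k with
  | zero => exact ⟨_, Real.hasDerivAt_sin x, by simp [Bk]⟩
  | succ k => exact ⟨_, Bk_deriv k x, by rw [Bk_rec]; push_cast; ring⟩

lemma Bk_zero (k : ℕ) : Bk k 0 = 0 := by
  induction k with
  | zero => simp [Bk]
  | succ k ih =>
    obtain ⟨b, _, h⟩ := Bk_deriv2 k 0
    rw [← h, ih]; simp

lemma Bk_cont (k : ℕ) : Continuous (Bk k) :=
  continuous_iff_continuousAt.2 fun x => (Bk_deriv2 k x).choose_spec.1.continuousAt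

/-! ### Link with `cc`, `ss` -/

lemma diag_deriv (p : ℕ) (h : ℝ) :
    HasDerivAt (cc (p + 1) (p + 1)) ((h / (p + 1) * cc p p h - ss (p + 1) (p + 1) h) / 2) h ∧
    HasDerivAt (ss (p + 1) (p + 1)) ((h / (p + 1) * ss p p h + cc (p + 1) (p + 1) h) / 2) h := by
  have hp : (p + 1 : ℝ) ≠ 0 := by positivity
  constructor
  · refine (cc_A (p + 1) p h).congr_deriv ?_
    have h1 := cc_D p p h
    have h2 := cc_C p p h
    field_simp
    linear_combination h2 + (p + 1 : ℝ) * h1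
  · refine (ss_A (p + 1) p h).congr_deriv ?_
    have h1 := ss_D p p h
    have h2 := ss_C p p h
    field_simp
    linear_combination h2 + (p + 1 : ℝ) * h1

lemma diag (p : ℕ) : ∃ κ : ℝ, κ ≠ 0 ∧ ∀ h,
    cc p p h * Real.cos (h / 2) + ss p p h * Real.sin (h / 2) = κ * Bk p (h / 2) ∧
    ss p p h * Real.cos (h / 2) - cc p p h * Real.sin (h / 2) = 0 := by
  induction p with
  | zero =>
    refine ⟨2, two_ne_zero, fun h => ?_⟩
    rw [cc00, ss00]
    have h1 : Real.sin h = 2 * Real.sin (h / 2) * Real.cos (h / 2) := by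
      rw [← Real.sin_two_mul]; ring_nf
    have h2 : Real.cos h = 2 * Real.cos (h / 2) ^ 2 - 1 := by
      rw [← Real.cos_two_mul]; ring_nf
    have h3 := Real.sin_sq_add_cos_sq (h / 2)
    rw [h1, h2]
    simp only [Bk]
    constructor
    · linear_combination (0 : ℝ) * h3
    · linear_combination -2 * Real.cos (h / 2) * h3
  | succ p ih =>
    obtain ⟨κ, hκ, H⟩ := ih
    have hp : (p + 1 : ℝ) ≠ 0 := by positivity
    have hhalf : ∀ h : ℝ, HasDerivAt (fun h : ℝ => h / 2) (1 / 2) h := fun h =>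
      (hasDerivAt_id h).div_const 2
    have hcos : ∀ h : ℝ, HasDerivAt (fun h : ℝ => Real.cos (h / 2)) (-Real.sin (h / 2) * (1 / 2)) h :=
      fun h => (hhalf h).cos
    have hsin : ∀ h : ℝ, HasDerivAt (fun h : ℝ => Real.sin (h / 2)) (Real.cos (h / 2) * (1 / 2)) h :=
      fun h => (hhalf h).sin
    refine ⟨2 * κ / (p + 1), by positivity, fun h => ⟨?_, ?_⟩⟩
    · refine eq_of_hasDerivAt
        (f := fun h => cc (p+1) (p+1) h * Real.cos (h / 2) + ss (p+1) (p+1) h * Real.sin (h / 2))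
        (g := fun h => 2 * κ / (p + 1) * Bk (p + 1) (h / 2))
        (f' := fun h => h / (2 * (p + 1)) * (κ * Bk p (h / 2))) (fun x => ?_) (fun x => ?_) ?_ h
      · refine (((diag_deriv p x).1.mul (hcos x)).add ((diag_deriv p x).2.mul (hsin x))).congr_deriv ?_
        rw [← (H x).1]
        field_simp
        ring
      · have := ((Bk_deriv p (x / 2)).comp x (hhalf x)).const_mul (2 * κ / (p + 1))
        refine this.congr_deriv ?_
        field_simp
      · simp [cc, ss, Bk_zero]
    · refine eq_of_hasDerivAt
        (f := fun h => ss (p+1) (p+1) h * Real.cos (h / 2) - cc (p+1) (p+1) h * Real.sin (h / 2))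
        (g := fun h => 0)
        (f' := fun h => 0) (fun x => ?_) (fun x => hasDerivAt_const _ _) ?_ h
      · refine (((diag_deriv p x).2.mul (hcos x)).sub ((diag_deriv p x).1.mul (hsin x))).congr_deriv ?_
        have := (H x).2
        field_simp
        linear_combination x * this
      · simp [cc, ss]

lemma diag_sq (p : ℕ) : ∃ κ : ℝ, κ ≠ 0 ∧ ∀ h, cc p p h ^ 2 + ss p p h ^ 2 = (κ * Bk p (h / 2)) ^ 2 := by
  obtain ⟨κ, hκ, H⟩ := diag p
  refine ⟨κ, hκ, fun h => ?_⟩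
  obtain ⟨h1, h2⟩ := H h
  have h3 := Real.sin_sq_add_cos_sq (h / 2)
  rw [← h1]
  linear_combination -(cc p p h ^ 2 + ss p p h ^ 2) * h3 +
    (ss p p h * Real.cos (h / 2) - cc p p h * Real.sin (h / 2)) * h2

lemma diag_pos {p : ℕ} {h : ℝ} (hB : Bk p (h / 2) ≠ 0) : 0 < cc p p h ^ 2 + ss p p h ^ 2 := by
  obtain ⟨κ, hκ, H⟩ := diag_sq p
  rw [H]; positivity

lemma diag_zero {p : ℕ} {h : ℝ} (hB : Bk p (h / 2) = 0) : cc p p h = 0 ∧ ss p p h = 0 := by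
  obtain ⟨κ, hκ, H⟩ := diag_sq p
  have := H h
  rw [hB] at this
  constructor <;> nlinarith [sq_nonneg (cc p p h), sq_nonneg (ss p p h)]

/-! ### Zeros of `Bk` -/

lemma Bk_zeros (k : ℕ) : ∀ X : ℝ, ∃ x, X < x ∧ Bk k x = 0 := by
  induction k with
  | zero =>
    intro X
    obtain ⟨n, hn⟩ := exists_nat_gt (X / Real.pi)
    refine ⟨n * Real.pi, ?_, Real.sin_nat_mul_pi n⟩
    rwa [div_lt_iff₀ Real.pi_pos] at hn
  | succ k ih =>
    intro X
    obtain ⟨a, ha, ha0⟩ := ih (max X 0)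
    obtain ⟨b, hb, hb0⟩ := ih a
    have ha' : 0 < a := lt_of_le_of_lt (le_max_right _ _) ha
    have haX : X < a := lt_of_le_of_lt (le_max_left _ _) ha
    have hd : ∀ x, 0 < x → HasDerivAt (fun x => Bk k x / x ^ (2 * k + 1))
        (- Bk (k + 1) x / x ^ (2 * k + 2)) x := by
      intro x hx
      obtain ⟨b, hb, hb2⟩ := Bk_deriv2 k x
      refine (hb.div (hasDerivAt_pow (2 * k + 1) x) (by positivity)).congr_deriv ?_
      rw [← hb2]
      have : x ≠ 0 := hx.ne'
      push_cast
      field_simp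
      ring
    obtain ⟨c, hc, hc0⟩ := exists_hasDerivAt_eq_zero hb
      (f := fun x => Bk k x / x ^ (2 * k + 1)) (f' := fun x => - Bk (k + 1) x / x ^ (2 * k + 2))
      (fun x hx => (hd x (lt_of_lt_of_le ha' hx.1)).continuousAt.continuousWithinAt)
      (by simp [ha0, hb0]) (fun x hx => hd x (ha'.trans hx.1))
    have hcp : 0 < c := ha'.trans hc.1
    refine ⟨c, haX.trans hc.1, ?_⟩
    have : c ^ (2 * k + 2) ≠ 0 := by positivity
    rw [div_eq_zero_iff] at hc0
    simpa [this] using hc0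

def jz (k : ℕ) : ℝ := sInf {x : ℝ | 0 < x ∧ Bk k x = 0}

lemma jz_of {k : ℕ} {a : ℝ} (ha : 0 < a) (hpos : ∀ x, 0 < x → x ≤ a → 0 < Bk k x) :
    a < jz k ∧ Bk k (jz k) = 0 ∧ ∀ x, 0 < x → x < jz k → 0 < Bk k x := by
  set S := {x : ℝ | 0 < x ∧ Bk k x = 0} with hS
  have hne : S.Nonempty := by
    obtain ⟨x, hx, hx0⟩ := Bk_zeros k 0
    exact ⟨x, hx, hx0⟩
  have hlb : ∀ x ∈ S, a ≤ x := by
    rintro x ⟨hx, hx0⟩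
    by_contra hlt
    exact (hpos x hx (not_le.1 hlt).le).ne' hx0
  have hbdd : BddBelow S := ⟨a, hlb⟩
  have hcl : jz k ∈ closure S := csInf_mem_closure hne hbdd
  have hz : Bk k (jz k) = 0 := by
    have : closure S ⊆ {x | Bk k x = 0} :=
      closure_minimal (fun x hx => hx.2) (isClosed_eq (Bk_cont k) continuous_const)
    exact this hcl
  have haj : a ≤ jz k := le_csInf hne hlb
  have haj' : a < jz k := lt_of_le_of_ne haj (fun h => (hpos a ha le_rfl).ne' (h ▸ hz))
  refine ⟨haj', hz, fun x hx hxj => ?_⟩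
  by_contra hn
  rcases le_or_gt x a with hxa | hxa
  · exact hn (hpos x hx hxa)
  · obtain ⟨c, hc, hc0⟩ := intermediate_value_Icc' hxa.le (Bk_cont k).continuousOn
      ⟨not_lt.1 hn, (hpos a ha le_rfl).le⟩
    have : jz k ≤ c := csInf_le hbdd ⟨lt_of_lt_of_le ha hc.1, hc0⟩
    linarith [hc.2]

lemma jz_prop (k : ℕ) : 0 < jz k ∧ Bk k (jz k) = 0 ∧ ∀ x, 0 < x → x < jz k → 0 < Bk k x := by
  have step : ∀ k, 0 < jz k → (∀ x, 0 < x → x < jz k → 0 < Bk k x) →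
      ∀ x, 0 < x → x ≤ jz k → 0 < Bk (k + 1) x := by
    intro k h0 hp x hx hxj
    have : StrictMonoOn (Bk (k + 1)) (Set.Icc 0 (jz k)) := by
      refine strictMonoOn_of_deriv_pos (convex_Icc _ _) (Bk_cont _).continuousOn (fun y hy => ?_)
      rw [interior_Icc] at hy
      rw [(Bk_deriv k y).deriv]
      exact mul_pos hy.1 (hp y hy.1 hy.2)
    have := this ⟨le_rfl, h0.le⟩ ⟨hx.le, hxj⟩ hx
    rwa [Bk_zero] at this
  induction k with
  | zero =>
    have := jz_of (k := 0) (a := 1) one_pos (fun x hx hx1 =>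
      Real.sin_pos_of_pos_of_lt_pi hx (by linarith [Real.pi_gt_three]))
    exact ⟨one_pos.trans this.1, this.2⟩
  | succ k ih =>
    have := jz_of (k := k + 1) (a := jz k) ih.1 (step k ih.1 ih.2.2)
    exact ⟨ih.1.trans this.1, this.2⟩

lemma jz_lt (k : ℕ) : jz k < jz (k + 1) := by
  obtain ⟨h0, hz, hp⟩ := jz_prop k
  refine (jz_of (k := k + 1) (a := jz k) h0 ?_).1
  intro x hx hxj
  have : StrictMonoOn (Bk (k + 1)) (Set.Icc 0 (jz k)) := by
    refine strictMonoOn_of_deriv_pos (convex_Icc _ _) (Bk_cont _).continuousOn (fun y hy => ?_)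
    rw [interior_Icc] at hy
    rw [(Bk_deriv k y).deriv]
    exact mul_pos hy.1 (hp y hy.1 hy.2)
  have := this ⟨le_rfl, h0.le⟩ ⟨hx.le, hxj⟩ hx
  rwa [Bk_zero] at this

/-! ### Critical length -/

lemma critLen_eq {n : ℕ} {a : Fin (n + 1) → ℝ} {h0 : ℝ} (hp : 0 < h0)
    (h1 : ∀ h, 0 < h → h < h0 → IsECOn n a (Set.Icc 0 h))
    (h2 : ∀ h, h0 ≤ h → ¬ IsECOn n a (Set.Icc 0 h)) : critLen n a = (h0 : EReal) := by
  apply le_antisymm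
  · apply sSup_le
    rintro l ⟨h, rfl, hh, hE⟩
    by_contra hlt
    rw [not_le, EReal.coe_lt_coe_iff] at hlt
    exact h2 h hlt.le hE
  · apply le_of_forall_lt
    intro c hc
    obtain ⟨h, hh1, hh2⟩ := EReal.lt_iff_exists_real_btwn.1 (max_lt hc (EReal.coe_lt_coe_iff.2 hp))
    refine lt_of_lt_of_le (lt_of_le_of_lt (le_max_left _ _) hh1) (le_sSup ⟨h, rfl, ?_, ?_⟩)
    · exact EReal.coe_lt_coe_iff.1 (lt_of_le_of_lt (le_max_right _ _) hh1)
    · exact h1 h (EReal.coe_lt_coe_iff.1 (lt_of_le_of_lt (le_max_right _ _) hh1))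
        (EReal.coe_lt_coe_iff.1 hh2)

lemma isEC_of {m : ℕ} {J : Set ℝ}
    (H : ∀ F, Ker m F → HasZeros F J (m + 2) → F = 0) :
    IsECOn (m + 1) (trigCoeff (m + 1)) J := by
  intro F hF hF0 r xs μ hx hinj h1 h2 hv
  by_contra hlt
  apply hF0
  refine H F ((ker_iff m F).1 hF) ⟨Finset.univ.image xs, Function.extend xs μ 0, ?_, ?_, ?_⟩
  · intro x hx'
    obtain ⟨i, -, rfl⟩ := Finset.mem_image.1 hx'
    exact hx i
  · intro x hx'
    obtain ⟨i, -, rfl⟩ := Finset.mem_image.1 hx'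
    rw [hinj.extend_apply]
    exact hv i
  · rw [Finset.sum_image (fun a _ b _ h => hinj h)]
    simp only [hinj.extend_apply]
    omega

lemma not_isEC_of {m : ℕ} {h h' : ℝ} {F : ℝ → ℝ} {i j : ℕ} (hh : 0 < h) (hh' : h ≤ h')
    (hF0 : F ≠ 0) (hF : Ker m F) (hi1 : 1 ≤ i) (hj1 : 1 ≤ j) (hi : VanishAtLeast F i 0)
    (hj : VanishAtLeast F j h) (hi2 : i ≤ m + 2) (hj2 : j ≤ m + 2) (hij : m + 1 < i + j) :
    ¬ IsECOn (m + 1) (trigCoeff (m + 1)) (Set.Icc 0 h') := by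
  intro hE
  have := hE F ((ker_iff m F).2 hF) hF0 2 ![0, h] ![i, j] ?_ ?_ ?_ ?_ ?_
  · simp at this; omega
  · intro a; fin_cases a
    · exact ⟨le_rfl, hh.le.trans hh'⟩
    · exact ⟨hh.le, hh'⟩
  · intro a b hab
    fin_cases a <;> fin_cases b <;> simp at hab ⊢
    · exact hh.ne hab
    · exact hh.ne' hab
  · intro a; fin_cases a <;> simpa
  · intro a; fin_cases a <;> simpa
  · intro a; fin_cases a <;> simpa

lemma crit_even (k : ℕ) :
    critLen (2 * (k + 1)) (trigCoeff (2 * (k + 1))) = ((2 * jz k : ℝ) : EReal) := by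
  obtain ⟨h0, hz, hp⟩ := jz_prop k
  have H : ∀ x, 0 < x → x < 2 * jz k → 0 < cc k k x ^ 2 + ss k k x ^ 2 := fun x hx hx2 =>
    diag_pos (hp (x / 2) (by linarith) (by linarith)).ne'
  obtain ⟨hc, hs⟩ := diag_zero (p := k) (h := 2 * jz k) (by rw [mul_div_cancel_left₀ _ two_ne_zero]; exact hz)
  refine critLen_eq (n := 2 * k + 1 + 1) (a := trigCoeff (2 * k + 1 + 1)) (by linarith) ?_ ?_
  · intro h _ hlt
    exact isEC_of (fun F hF hzs => EC_even H hlt hF hzs)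
  · intro h hle
    obtain ⟨F, hF0, hF, hv1, hv2⟩ := bad_even (k := k) (h := 2 * jz k) (by linarith) hc hs
    exact not_isEC_of (by linarith) hle hF0 hF (by omega) (by omega) hv1 hv2 (by omega) (by omega)
      (by omega)

lemma crit_odd (k : ℕ) :
    critLen (2 * (k + 1) + 1) (trigCoeff (2 * (k + 1) + 1)) = ((2 * jz k : ℝ) : EReal) := by
  obtain ⟨h0, hz, hp⟩ := jz_prop k
  have H : ∀ x, 0 < x → x < 2 * jz k → 0 < cc k k x ^ 2 + ss k k x ^ 2 := fun x hx hx2 =>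
    diag_pos (hp (x / 2) (by linarith) (by linarith)).ne'
  obtain ⟨hc, hs⟩ := diag_zero (p := k) (h := 2 * jz k) (by rw [mul_div_cancel_left₀ _ two_ne_zero]; exact hz)
  refine critLen_eq (n := 2 * k + 2 + 1) (a := trigCoeff (2 * k + 2 + 1)) (by linarith) ?_ ?_
  · intro h _ hlt
    exact isEC_of (fun F hF hzs => EC_odd H hlt hF hzs)
  · intro h hle
    obtain ⟨F, hF0, hF, hv1, hv2⟩ := bad_odd (k := k) (h := 2 * jz k) (by linarith) hc hs
    exact not_isEC_of (by linarith) hle hF0 hF (by omega) (by omega) hv1 hv2 (by omega) (by omega)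
      (by omega)

/-! ### Bessel functions -/

def bT (k : ℕ) (x : ℝ) (m : ℕ) : ℝ :=
  (-1 : ℝ) ^ m / ((m.factorial : ℝ) * Real.Gamma ((m : ℝ) + k + 1 / 2)) * (x / 2) ^ (2 * m)

lemma hs_congr {f g : ℕ → ℝ} {a : ℝ} (h : ∀ m, f m = g m) (hg : HasSum g a) : HasSum f a := by
  rwa [funext h]

lemma bT_rec (k : ℕ) (x : ℝ) (hx : x ≠ 0) {s0 s1 : ℝ} (h0 : HasSum (bT k x) s0)
    (h1 : HasSum (bT (k + 1) x) s1) :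
    HasSum (bT (k + 2) x) (((k + 1 / 2) * s1 - s0) * 4 / x ^ 2) := by
  have hG : ∀ m : ℕ, Real.Gamma ((m : ℝ) + k + 1 / 2 + 1) =
      ((m : ℝ) + k + 1 / 2) * Real.Gamma ((m : ℝ) + k + 1 / 2) := fun m =>
    Real.Gamma_add_one (by positivity)
  have hGp : ∀ m : ℕ, 0 < Real.Gamma ((m : ℝ) + k + 1 / 2) := fun m =>
    Real.Gamma_pos_of_pos (by positivity)
  have h2 := (h1.mul_left (k + 1 / 2 : ℝ)).sub h0
  have h3 : ∀ m : ℕ, (k + 1 / 2 : ℝ) * bT (k + 1) x m - bT k x m =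
      - (m : ℝ) * bT (k + 1) x m := by
    intro m
    have e : ((m : ℝ) + ((k + 1 : ℕ) : ℝ) + 1 / 2) = (m : ℝ) + k + 1 / 2 + 1 := by push_cast; ring
    have hm : (m.factorial : ℝ) ≠ 0 := by positivity
    have hg := (hGp m).ne'
    have hmk : ((m : ℝ) + k + 1 / 2) ≠ 0 := by positivity
    simp only [bT]
    rw [e, hG]
    generalize Real.Gamma ((m : ℝ) + k + 1 / 2) = g at *
    generalize (x / 2) ^ (2 * m) = y at *
    generalize (-1 : ℝ) ^ m = z at *
    have : (2 * ((m : ℝ) + k) + 1) ≠ 0 := by positivity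
    field_simp
    ring
  simp only [h3] at h2
  have h4 := (hasSum_nat_add_iff' 1).2 h2
  simp only [Finset.range_one, Finset.sum_singleton, Nat.cast_zero, neg_zero, zero_mul, sub_zero] at h4
  have h5 := (h4.mul_right (4 / x ^ 2))
  rw [mul_div_assoc]
  refine hs_congr (fun m => ?_) h5
  simp only [bT]
  have e : (((m + 1 : ℕ) : ℝ) + ((k + 1 : ℕ) : ℝ) + 1 / 2) = (m : ℝ) + ((k + 2 : ℕ) : ℝ) + 1 / 2 := by
    push_cast; ring
  rw [e, Nat.factorial_succ]
  have hm : (m.factorial : ℝ) ≠ 0 := by positivity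
  have hm1 : (m + 1 : ℝ) ≠ 0 := by positivity
  have hg : Real.Gamma ((m : ℝ) + ((k + 2 : ℕ) : ℝ) + 1 / 2) ≠ 0 :=
    (Real.Gamma_pos_of_pos (by positivity)).ne'
  generalize Real.Gamma ((m : ℝ) + ((k + 2 : ℕ) : ℝ) + 1 / 2) = g at *
  rw [mul_add 2 m 1, pow_add, pow_add]
  generalize hy : (x / 2) ^ (2 * m) = y
  push_cast
  field_simp
  ring

lemma bT_zero (x : ℝ) : HasSum (bT 0 x) (Real.cos x / Real.sqrt Real.pi) := by
  have h := (Real.hasSum_cos x).div_const (Real.sqrt Real.pi)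
  refine hs_congr (fun m => ?_) h
  have hG := Real.Gamma_mul_Gamma_add_half ((m : ℝ) + 1 / 2)
  have e1 : (m : ℝ) + 1 / 2 + 1 / 2 = m + 1 := by ring
  have e2 : 2 * ((m : ℝ) + 1 / 2) = ((2 * m : ℕ) : ℝ) + 1 := by push_cast; ring
  have e3 : (1 : ℝ) - (((2 * m : ℕ) : ℝ) + 1) = - ((2 * m : ℕ) : ℝ) := by ring
  rw [e1, e2, e3, Real.Gamma_nat_eq_factorial, Real.Gamma_nat_eq_factorial,
    Real.rpow_neg (by norm_num), Real.rpow_natCast] at hG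
  have hpi : Real.sqrt Real.pi ≠ 0 := (Real.sqrt_pos.2 Real.pi_pos).ne'
  have hf : ((2 * m).factorial : ℝ) ≠ 0 := by positivity
  simp only [bT, Nat.cast_zero, add_zero]
  rw [mul_comm (m.factorial : ℝ), hG, div_pow]
  field_simp

lemma bT_one (x : ℝ) (hx : x ≠ 0) : HasSum (bT 1 x) (2 / (Real.sqrt Real.pi * x) * Real.sin x) := by
  have h := (Real.hasSum_sin x).mul_left (2 / (Real.sqrt Real.pi * x))
  refine hs_congr (fun m => ?_) h
  have hG := Real.Gamma_mul_Gamma_add_half ((m : ℝ) + 1)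
  have e2 : 2 * ((m : ℝ) + 1) = ((2 * m + 1 : ℕ) : ℝ) + 1 := by push_cast; ring
  have e3 : (1 : ℝ) - (((2 * m + 1 : ℕ) : ℝ) + 1) = - ((2 * m + 1 : ℕ) : ℝ) := by ring
  rw [e2, e3, Real.Gamma_nat_eq_factorial, Real.Gamma_nat_eq_factorial,
    Real.rpow_neg (by norm_num), Real.rpow_natCast] at hG
  have hpi : Real.sqrt Real.pi ≠ 0 := (Real.sqrt_pos.2 Real.pi_pos).ne'
  have hf : ((2 * m + 1).factorial : ℝ) ≠ 0 := by positivity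
  simp only [bT, Nat.cast_one]
  rw [hG, div_pow, pow_succ, pow_succ]
  field_simp

lemma bT_sum (k : ℕ) (x : ℝ) (hx : x ≠ 0) :
    HasSum (bT (k + 1) x) (2 ^ (k + 1) / (Real.sqrt Real.pi * x ^ (2 * k + 1)) * Bk k x) ∧
    HasSum (bT (k + 2) x) (2 ^ (k + 2) / (Real.sqrt Real.pi * x ^ (2 * k + 3)) * Bk (k + 1) x) := by
  have hpi : Real.sqrt Real.pi ≠ 0 := (Real.sqrt_pos.2 Real.pi_pos).ne'
  induction k with
  | zero =>
    have h1 := bT_one x hx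
    refine ⟨by simpa [Bk] using h1, ?_⟩
    convert bT_rec 0 x hx (bT_zero x) h1 using 1
    simp only [Bk, Nat.cast_zero]
    field_simp
    ring
  | succ k ih =>
    refine ⟨ih.2, ?_⟩
    convert bT_rec (k + 1) x hx ih.1 ih.2 using 1
    rw [Bk_rec]
    push_cast
    field_simp
    ring

lemma bessel_eq (k : ℕ) {x : ℝ} (hx : 0 < x) : besselJ (((k + 1 : ℕ) : ℝ) - 1 / 2) x =
    (x / 2) ^ (((k + 1 : ℕ) : ℝ) - 1 / 2) *
      (2 ^ (k + 1) / (Real.sqrt Real.pi * x ^ (2 * k + 1)) * Bk k x) := by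
  rw [← ((bT_sum k x hx.ne').1.mul_left _).tsum_eq, besselJ]
  congr 1
  ext m
  have e : (m : ℝ) + (((k + 1 : ℕ) : ℝ) - 1 / 2) + 1 = m + ((k + 1 : ℕ) : ℝ) + 1 / 2 := by ring
  have e2 : (2 * (m : ℝ)) = ((2 * m : ℕ) : ℝ) := by push_cast; ring
  rw [e, Real.rpow_add (by positivity), e2, Real.rpow_natCast, bT]
  ring

lemma bessel_zero (k : ℕ) : besselFirstZero (((k + 1 : ℕ) : ℝ) - 1 / 2) = jz k := by
  rw [besselFirstZero, jz]
  congr 1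
  ext x
  refine and_congr_right fun hx => ?_
  rw [bessel_eq k hx]
  have h1 : (x / 2) ^ (((k + 1 : ℕ) : ℝ) - 1 / 2) ≠ 0 := (Real.rpow_pos_of_pos (by positivity) _).ne'
  have hpi : 0 < Real.sqrt Real.pi := Real.sqrt_pos.2 Real.pi_pos
  have h2 : 2 ^ (k + 1) / (Real.sqrt Real.pi * x ^ (2 * k + 1)) ≠ 0 := by positivity
  rw [mul_eq_zero, mul_eq_zero, or_iff_right h1, or_iff_right h2]

/-- for every `k ≥ 1`, the critical lengths `ℓ_m` of `L_m = D^(m+1) + D^(m-1)`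
satisfy `ℓ_{2k} = ℓ_{2k+1} = 2 j_{k-1/2,1}` and `ℓ_{2k+1} < ℓ_{2k+2}`. -/
theorem stmt5 (k : ℕ) (hk : 1 ≤ k) :
    critLen (2 * k) (trigCoeff (2 * k)) = critLen (2 * k + 1) (trigCoeff (2 * k + 1)) ∧
    critLen (2 * k) (trigCoeff (2 * k)) =
      ((2 * besselFirstZero ((k : ℝ) - 1 / 2) : ℝ) : EReal) ∧
    critLen (2 * k + 1) (trigCoeff (2 * k + 1)) < critLen (2 * k + 2) (trigCoeff (2 * k + 2)) := by
  obtain ⟨k, rfl⟩ : ∃ j, k = j + 1 := ⟨k - 1, by omega⟩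
  refine ⟨by rw [crit_even, crit_odd], by rw [crit_even, bessel_zero], ?_⟩
  have h2 : critLen (2 * (k + 1) + 2) (trigCoeff (2 * (k + 1) + 2)) = ((2 * jz (k + 1) : ℝ) : EReal) :=
    crit_even (k + 1)
  rw [crit_odd, h2, EReal.coe_lt_coe_iff]
  linarith [jz_lt k]
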